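/- Let d = 2, W(z) = ½(1−|z|²)², and u^± = (a,±b) ∈ ℝ² with a² + b² = 1 and b > 0. If u is a global minimizer of problem (P), then u is one-dimensional: u(x) = g(x₁) with g ∈ C²(ℝ,ℝ²) the unique minimizer (up to translation in the x₁-variable) of the one-dimensional problem. -/

import Mathlib

open MeasureTheory Filter Topology ENNReal

noncomputable section

/-- Squared Euclidean norm on `ℝ^d` (modelled as `Fin d → ℝ`). -/
def vnorm2 {d : ℕ} (v : Fin d → ℝ) : ℝ := ∑ i, v i ^ 2

/-- Partial derivative in the `i`-th coordinate direction of a map `ℝ^d → ℝ^d`. -/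
def pd {d : ℕ} (i : Fin d) (u : (Fin d → ℝ) → Fin d → ℝ) (x : Fin d → ℝ) : Fin d → ℝ :=
  fderiv ℝ u x (Pi.single i 1)

/-- Partial derivative in the `i`-th coordinate direction of a scalar function on `ℝ^d`. -/
def pdS {d : ℕ} (i : Fin d) (w : (Fin d → ℝ) → ℝ) (x : Fin d → ℝ) : ℝ :=
  fderiv ℝ w x (Pi.single i 1)

/-- Squared Frobenius norm `|∇u|²` of the Jacobian of `u`. -/
def gradSq {d : ℕ} (u : (Fin d → ℝ) → Fin d → ℝ) (x : Fin d → ℝ) : ℝ :=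
  ∑ i, ∑ j, (pd i u x j) ^ 2

/-- Divergence-free condition `∇ ⋅ u = 0`. -/
def IsDivFree {d : ℕ} (u : (Fin d → ℝ) → Fin d → ℝ) : Prop :=
  ∀ x, ∑ i, pd i u x i = 0

/-- Periodicity (period 1) in the last `d-1` coordinates: `u` is a map on `Ω = ℝ × 𝕋^{d-1}`. -/
def IsPeriodic {d : ℕ} [NeZero d] (u : (Fin d → ℝ) → Fin d → ℝ) : Prop :=
  ∀ (x : Fin d → ℝ) (i : Fin d), i ≠ 0 → u (x + Pi.single i 1) = u x

/-- Fundamental domain `ℝ × [0,1)^{d-1}` of `Ω = ℝ × 𝕋^{d-1}`. -/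
def strip (d : ℕ) [NeZero d] : Set (Fin d → ℝ) :=
  {x | ∀ i : Fin d, i ≠ 0 → x i ∈ Set.Ico (0 : ℝ) 1}

/-- The unit cube `[0,1)^d`. -/
def cube (d : ℕ) : Set (Fin d → ℝ) := Set.univ.pi fun _ => Set.Ico (0 : ℝ) 1

/-- The `x'`-average `ū(t) = ∫_{𝕋^{d-1}} u(t,x') dx'`. -/
def avg {d : ℕ} [NeZero d] (u : (Fin d → ℝ) → Fin d → ℝ) (t : ℝ) : Fin d → ℝ :=
  ∫ y in cube d, u (Function.update y 0 t)

/-- Energy density `½|∇u|² + W(u)`. -/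
def eden {d : ℕ} (W : (Fin d → ℝ) → ℝ) (u : (Fin d → ℝ) → Fin d → ℝ) (x : Fin d → ℝ) : ℝ :=
  (1 / 2) * gradSq u x + W (u x)

/-- Total energy `E(u)` on `Ω`, with values in `[0,∞]`. -/
def energy (d : ℕ) [NeZero d] (W : (Fin d → ℝ) → ℝ) (u : (Fin d → ℝ) → Fin d → ℝ) : ℝ≥0∞ :=
  ∫⁻ x in strip d, ENNReal.ofReal (eden W u x)

/-- Membership in `Ḣ¹_div(Ω, ℝ^d)` (with classical derivatives). -/
def Adm (d : ℕ) [NeZero d] (u : (Fin d → ℝ) → Fin d → ℝ) : Prop :=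
  Differentiable ℝ u ∧ IsPeriodic u ∧ IsDivFree u ∧ IntegrableOn (gradSq u) (strip d)

/-- The boundary conditions `ū(-∞) = u⁻`, `ū(+∞) = u⁺`. -/
def BdryCond (d : ℕ) [NeZero d] (u : (Fin d → ℝ) → Fin d → ℝ) (um up : Fin d → ℝ) : Prop :=
  Tendsto (avg u) atBot (𝓝 um) ∧ Tendsto (avg u) atTop (𝓝 up)

/-- `S_a`: the zeros of `W` in the hyperplane `{z₁ = a}`. -/
def wellSet (d : ℕ) [NeZero d] (W : (Fin d → ℝ) → ℝ) (a : ℝ) : Set (Fin d → ℝ) :=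
  {z | z 0 = a ∧ W z = 0}

/-- Hypothesis (H2): `liminf_{z₁ → a, |z'| → ∞} W(z₁,z') > 0`. -/
def H2cond (d : ℕ) [NeZero d] (W : (Fin d → ℝ) → ℝ) (a : ℝ) : Prop :=
  ∃ c > (0 : ℝ), ∃ δ > (0 : ℝ), ∃ R : ℝ, ∀ z : Fin d → ℝ,
    |z 0 - a| < δ → R ≤ ∑ i, (if i = (0 : Fin d) then 0 else z i ^ 2) → c ≤ W z

/-- An admissible one-dimensional transition layer: a curve in the hyperplane `{z₁ = a}`
connecting `u⁻` (at `-∞`) to `u⁺` (at `+∞`). -/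
def Adm1D (d : ℕ) [NeZero d] (a : ℝ) (um up : Fin d → ℝ) (γ : ℝ → Fin d → ℝ) : Prop :=
  Differentiable ℝ γ ∧ (∀ t, γ t 0 = a) ∧
  Tendsto γ atBot (𝓝 um) ∧ Tendsto γ atTop (𝓝 up)

/-- One-dimensional energy `∫_ℝ ½|γ̇|² + W(γ)`. -/
def energy1D (d : ℕ) (W : (Fin d → ℝ) → ℝ) (γ : ℝ → Fin d → ℝ) : ℝ≥0∞ :=
  ∫⁻ t : ℝ, ENNReal.ofReal ((1 / 2) * vnorm2 (deriv γ t) + W (γ t))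

/-- Geodesic (pseudo-)distance `geod^a_F(x,y)` in the hyperplane `{z₁ = a}` for the degenerate
metric `2 F g₀`: infimum of `∫_{-1}^{1} √(2F(γ)) |γ̇| dt` over Lipschitz curves in the
hyperplane joining `x` to `y`. -/
def geodA (d : ℕ) [NeZero d] (F : (Fin d → ℝ) → ℝ) (a : ℝ) (x y : Fin d → ℝ) : ℝ :=
  sInf {L | ∃ γ : ℝ → Fin d → ℝ, (∃ K : NNReal, LipschitzWith K γ) ∧ (∀ t, γ t 0 = a) ∧
    γ (-1) = x ∧ γ 1 = y ∧
    L = ∫ t in Set.Icc (-1 : ℝ) 1, Real.sqrt (2 * F (γ t)) * Real.sqrt (vnorm2 (deriv γ t))}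


section OneDim

/-- A function whose derivative agrees almost everywhere with a continuous function has that
function as its derivative everywhere. -/
lemma deriv_eq_of_ae_eq_continuous {φ φ' h : ℝ → ℝ} (hφ : ∀ x, HasDerivAt φ (φ' x) x)
    (hh : Continuous h) (hae : φ' =ᵐ[volume] h) (x : ℝ) : φ' x = h x := by
  have key : ∀ t, φ t = φ 0 + ∫ s in (0 : ℝ)..t, h s := by
    intro t
    have hi : IntervalIntegrable φ' volume 0 t :=
      (hh.intervalIntegrable 0 t).congr_ae (ae_restrict_of_ae hae.symm)
    have h1 := intervalIntegral.integral_eq_sub_of_hasDerivAt (fun s _ => hφ s) hi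
    have h2 : ∫ s in (0 : ℝ)..t, φ' s = ∫ s in (0 : ℝ)..t, h s :=
      intervalIntegral.integral_congr_ae (hae.mono fun s hs _ => hs)
    linarith
  have h3 : HasDerivAt φ (h x) x := by
    have := (intervalIntegral.integral_hasDerivAt_right (hh.intervalIntegrable 0 x)
      hh.stronglyMeasurable.stronglyMeasurableAtFilter hh.continuousAt).const_add (φ 0)
    exact this.congr_of_eventuallyEq (Eventually.of_forall key)
  exact (hφ x).unique h3

/-- The one-dimensional transition layer. -/
def layer (b t : ℝ) : ℝ := b * Real.tanh (b * t)

lemma hasDerivAt_layer (b t : ℝ) : HasDerivAt (layer b) (b ^ 2 - layer b t ^ 2) t := by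
  have hc : Real.cosh (b * t) ≠ 0 := (Real.cosh_pos _).ne'
  have h1 : HasDerivAt (fun t => b * t) b t := by simpa using (hasDerivAt_id t).const_mul b
  have h := ((h1.sinh.div h1.cosh hc).const_mul b)
  have e : layer b = fun t => b * (Real.sinh (b * t) / Real.cosh (b * t)) := by
    funext t; simp [layer, Real.tanh_eq_sinh_div_cosh]
  rw [e]
  refine h.congr_deriv ?_
  field_simp

lemma layer_sq_le (b t : ℝ) : layer b t ^ 2 ≤ b ^ 2 := by
  have := Real.tanh_sq_lt_one (b * t)
  simp only [layer, mul_pow]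
  nlinarith [sq_nonneg b]

lemma tendsto_tanh_atTop : Tendsto Real.tanh atTop (𝓝 1) := by
  have e : Real.tanh = fun x => 1 - 2 * (Real.exp (2 * x) + 1)⁻¹ := by
    funext x
    have : Real.exp (2 * x) + 1 ≠ 0 := by positivity
    have h0 : Real.exp x + Real.exp (-x) ≠ 0 := by positivity
    have h1 : Real.exp (2 * x) = Real.exp x * Real.exp x := by rw [← Real.exp_add]; ring_nf
    have h2 : Real.exp x * Real.exp (-x) = 1 := by rw [← Real.exp_add]; simp
    rw [Real.tanh_eq]
    rw [h1] at this ⊢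
    field_simp
    linear_combination (-2 * Real.exp x) * h2
  rw [e]
  have h1 : Tendsto (fun x : ℝ => Real.exp (2 * x) + 1) atTop atTop :=
    tendsto_atTop_add_const_right _ _
      (Real.tendsto_exp_atTop.comp (tendsto_id.const_mul_atTop two_pos))
  simpa using (h1.inv_tendsto_atTop.const_mul 2).const_sub 1

lemma tendsto_layer_atTop {b : ℝ} (hb : 0 < b) : Tendsto (layer b) atTop (𝓝 b) := by
  have h := (tendsto_tanh_atTop.comp (tendsto_id.const_mul_atTop hb)).const_mul b
  rw [mul_one] at h
  exact h

lemma layer_neg (b t : ℝ) : layer b (-t) = -layer b t := by simp [layer]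

lemma tendsto_layer_atBot {b : ℝ} (hb : 0 < b) : Tendsto (layer b) atBot (𝓝 (-b)) := by
  have h := ((tendsto_layer_atTop hb).comp tendsto_neg_atBot_atTop).neg
  refine h.congr fun t => ?_
  simp [layer_neg]

lemma contDiff_layer (b : ℝ) : ContDiff ℝ 2 (layer b) := by
  have e : layer b = fun t => b * (Real.sinh (b * t) / Real.cosh (b * t)) := by
    funext t; simp [layer, Real.tanh_eq_sinh_div_cosh]
  rw [e]
  have h : ContDiff ℝ 2 (fun t : ℝ => b * t) := contDiff_const.mul contDiff_id
  exact contDiff_const.mul (h.sinh.div h.cosh fun t => (Real.cosh_pos _).ne')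

/-- Heteroclinic solutions of `φ' = b² - φ²` are translates of the layer. -/
lemma eq_layer_of_ode {b : ℝ} (hb : 0 < b) {φ : ℝ → ℝ}
    (hφ : ∀ t, HasDerivAt φ (b ^ 2 - φ t ^ 2) t)
    (hbot : Tendsto φ atBot (𝓝 (-b))) (htop : Tendsto φ atTop (𝓝 b)) :
    ∃ τ, ∀ t, φ t = layer b (t + τ) := by
  have hc : Continuous φ := continuous_iff_continuousAt.2 fun t => (hφ t).continuousAt
  obtain ⟨t₀, ht₀⟩ : ∃ t₀, φ t₀ = 0 :=
    mem_range_of_exists_le_of_exists_ge hc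
      ((hbot.eventually (eventually_le_nhds (show -b < 0 by linarith))).exists)
      ((htop.eventually (eventually_ge_nhds hb)).exists)
  refine ⟨-t₀, ?_⟩
  set ψ : ℝ → ℝ := fun t => layer b (t + -t₀) with hψ
  have hψd : ∀ t, HasDerivAt ψ (b ^ 2 - ψ t ^ 2) t := fun t => by
    simpa using (hasDerivAt_layer b (t + -t₀)).comp_add_const t (-t₀)
  have hψc : Continuous ψ := continuous_iff_continuousAt.2 fun t => (hψd t).continuousAt
  have hsum : Continuous fun t => φ t + ψ t := hc.add hψc
  set I : ℝ → ℝ := fun t => ∫ s in t₀..t, (φ s + ψ s)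
  have hI : ∀ t, HasDerivAt I (φ t + ψ t) t := fun t =>
    intervalIntegral.integral_hasDerivAt_right (hsum.intervalIntegrable _ _)
      hsum.stronglyMeasurable.stronglyMeasurableAtFilter hsum.continuousAt
  have hZ : ∀ t, HasDerivAt (fun t => (φ t - ψ t) * Real.exp (I t)) 0 t := fun t => by
    refine (((hφ t).sub (hψd t)).mul (hI t).exp).congr_deriv ?_
    simp only [Pi.sub_apply]
    ring
  have hconst := is_const_of_deriv_eq_zero (fun t => (hZ t).differentiableAt)
    (fun t => (hZ t).deriv)
  intro t
  have h := hconst t t₀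
  have h0 : ψ t₀ = 0 := by simp [hψ, layer]
  simp only [ht₀, h0, sub_self, zero_mul, mul_eq_zero, Real.exp_ne_zero, or_false] at h
  linarith

lemma integral_calibration_oneDim {b : ℝ} {φ φ' : ℝ → ℝ} (hφ : ∀ t, HasDerivAt φ (φ' t) t)
    (hbot : Tendsto φ atBot (𝓝 (-b))) (htop : Tendsto φ atTop (𝓝 b))
    (hi : Integrable fun t => φ' t * (b ^ 2 - φ t ^ 2)) :
    ∫ t, φ' t * (b ^ 2 - φ t ^ 2) = 4 * b ^ 3 / 3 := by
  have hd : ∀ t, HasDerivAt (fun t => b ^ 2 * φ t - φ t ^ 3 / 3) (φ' t * (b ^ 2 - φ t ^ 2)) t :=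
    fun t => by
      refine (((hφ t).const_mul (b ^ 2)).sub (((hφ t).pow 3).div_const 3)).congr_deriv ?_
      simp; ring
  rw [integral_of_hasDerivAt_of_tendsto hd hi
    ((hbot.const_mul (b ^ 2)).sub ((hbot.pow 3).div_const 3))
    ((htop.const_mul (b ^ 2)).sub ((htop.pow 3).div_const 3))]
  ring

/-- The one-dimensional energy is minimal exactly for solutions of `φ' = b² - φ²`. -/
lemma ode_of_energy_le {b : ℝ} (hb : 0 < b) {φ φ' : ℝ → ℝ} (hφ : ∀ t, HasDerivAt φ (φ' t) t)
    (hbot : Tendsto φ atBot (𝓝 (-b))) (htop : Tendsto φ atTop (𝓝 b))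
    (hE : ∫⁻ t, ENNReal.ofReal (1 / 2 * φ' t ^ 2 + 1 / 2 * (b ^ 2 - φ t ^ 2) ^ 2)
      ≤ ENNReal.ofReal (4 * b ^ 3 / 3)) (t : ℝ) : φ' t = b ^ 2 - φ t ^ 2 := by
  have hc : Continuous φ := continuous_iff_continuousAt.2 fun t => (hφ t).continuousAt
  have hm : Measurable φ' := by
    have : φ' = deriv φ := funext fun t => (hφ t).deriv.symm
    rw [this]; exact measurable_deriv φ
  have hnn : ∀ t, 0 ≤ 1 / 2 * φ' t ^ 2 + 1 / 2 * (b ^ 2 - φ t ^ 2) ^ 2 := fun t => by positivity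
  have hmeas : AEStronglyMeasurable
      (fun t => 1 / 2 * φ' t ^ 2 + 1 / 2 * (b ^ 2 - φ t ^ 2) ^ 2) volume := by
    have := hc.measurable
    exact Measurable.aestronglyMeasurable (by fun_prop)
  have hInt : Integrable fun t => 1 / 2 * φ' t ^ 2 + 1 / 2 * (b ^ 2 - φ t ^ 2) ^ 2 :=
    ⟨hmeas, (hasFiniteIntegral_iff_ofReal (ae_of_all _ hnn)).2 (hE.trans_lt ofReal_lt_top)⟩
  have hi : Integrable fun t => φ' t * (b ^ 2 - φ t ^ 2) := by
    have := hc.measurable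
    refine hInt.mono' (Measurable.aestronglyMeasurable (by fun_prop)) (ae_of_all _ fun t => ?_)
    rw [Real.norm_eq_abs, abs_le]
    constructor <;> nlinarith [sq_nonneg (φ' t - (b ^ 2 - φ t ^ 2)),
      sq_nonneg (φ' t + (b ^ 2 - φ t ^ 2))]
  have hcal := integral_calibration_oneDim hφ hbot htop hi
  have hle : ∫ t, (1 / 2 * φ' t ^ 2 + 1 / 2 * (b ^ 2 - φ t ^ 2) ^ 2) ≤ 4 * b ^ 3 / 3 := by
    rw [integral_eq_lintegral_of_nonneg_ae (ae_of_all _ hnn) hmeas]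
    exact ENNReal.toReal_le_of_le_ofReal (by positivity) hE
  have hsq : Integrable fun t => 1 / 2 * (φ' t - (b ^ 2 - φ t ^ 2)) ^ 2 :=
    (hInt.sub hi).congr (ae_of_all _ fun t => by simp only [Pi.sub_apply]; ring)
  have hz : ∫ t, 1 / 2 * (φ' t - (b ^ 2 - φ t ^ 2)) ^ 2 = 0 := by
    refine le_antisymm ?_ (integral_nonneg fun t => by positivity)
    have : ∫ t, 1 / 2 * (φ' t - (b ^ 2 - φ t ^ 2)) ^ 2
        = (∫ t, (1 / 2 * φ' t ^ 2 + 1 / 2 * (b ^ 2 - φ t ^ 2) ^ 2))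
          - ∫ t, φ' t * (b ^ 2 - φ t ^ 2) := by
      rw [← integral_sub hInt hi]
      exact integral_congr_ae (ae_of_all _ fun t => by simp only []; ring)
    linarith
  rw [integral_eq_zero_iff_of_nonneg (fun t => by positivity) hsq] at hz
  refine deriv_eq_of_ae_eq_continuous (h := fun t => b ^ 2 - φ t ^ 2) hφ (by fun_prop) ?_ t
  filter_upwards [hz] with t ht
  have : (φ' t - (b ^ 2 - φ t ^ 2)) ^ 2 = 0 := by simpa using ht
  have := pow_eq_zero_iff (two_ne_zero) |>.1 this
  linarith

lemma integrable_layer_deriv_sq {b : ℝ} (hb : 0 < b) :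
    Integrable fun t => (b ^ 2 - layer b t ^ 2) ^ 2 := by
  have hnn : ∀ t, 0 ≤ b ^ 2 - layer b t ^ 2 := fun t => sub_nonneg.2 (layer_sq_le b t)
  have h1 : IntegrableOn (fun t => b ^ 2 - layer b t ^ 2) (Set.Ioi 0) :=
    integrableOn_Ioi_deriv_of_nonneg' (fun t _ => hasDerivAt_layer b t) (fun t _ => hnn t)
      (tendsto_layer_atTop hb)
  have h2 : IntegrableOn (fun t => b ^ 2 - layer b t ^ 2) (Set.Iic 0) := by
    rw [← integrableOn_Ici_iff_integrableOn_Ioi] at h1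
    rw [← integrable_indicator_iff measurableSet_Ici] at h1
    rw [← integrable_indicator_iff measurableSet_Iic]
    refine h1.comp_neg.congr (ae_of_all _ fun t => ?_)
    simp only [Set.indicator, Set.mem_Ici, Set.mem_Iic, layer_neg, Left.nonneg_neg_iff, neg_sq]
  have h3 : Integrable fun t => b ^ 2 - layer b t ^ 2 := by
    rw [← integrableOn_univ, ← Set.Iic_union_Ioi (a := (0 : ℝ))]
    exact h2.union h1
  have hc : Continuous (layer b) := (contDiff_layer b).continuous
  refine (h3.const_mul (b ^ 2)).mono' (by fun_prop) (ae_of_all _ fun t => ?_)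
  rw [Real.norm_of_nonneg (by positivity)]
  nlinarith [hnn t, layer_sq_le b t, sq_nonneg (layer b t)]

lemma lintegral_layer_deriv_sq {b : ℝ} (hb : 0 < b) :
    ∫⁻ t, ENNReal.ofReal ((b ^ 2 - layer b t ^ 2) ^ 2) = ENNReal.ofReal (4 * b ^ 3 / 3) := by
  have hi := integrable_layer_deriv_sq hb
  rw [← ofReal_integral_eq_lintegral_ofReal hi (ae_of_all _ fun t => by positivity)]
  congr 1
  rw [← integral_calibration_oneDim (hasDerivAt_layer b) (tendsto_layer_atBot hb)
    (tendsto_layer_atTop hb) (by simpa only [sq (b ^ 2 - _)] using hi)]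
  simp only [sq (b ^ 2 - _)]

end OneDim

section Strip

/-- Lebesgue measure on the strip `ℝ × (0, 1]`. -/
abbrev stripVol : Measure (ℝ × ℝ) := volume.prod (volume.restrict (Set.Ioc 0 1))

/-- First partial derivative of a function on the plane. -/
def dx (f : ℝ × ℝ → ℝ) (p : ℝ × ℝ) : ℝ := fderiv ℝ f p (1, 0)

/-- Second partial derivative of a function on the plane. -/
def dy (f : ℝ × ℝ → ℝ) (p : ℝ × ℝ) : ℝ := fderiv ℝ f p (0, 1)

lemma measurable_dx (f : ℝ × ℝ → ℝ) : Measurable (dx f) := measurable_fderiv_apply_const ℝ f _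

lemma measurable_dy (f : ℝ × ℝ → ℝ) : Measurable (dy f) := measurable_fderiv_apply_const ℝ f _

lemma hasDerivAt_dx {f : ℝ × ℝ → ℝ} (hf : Differentiable ℝ f) (x y : ℝ) :
    HasDerivAt (fun t => f (t, y)) (dx f (x, y)) x :=
  (hf (x, y)).hasFDerivAt.comp_hasDerivAt x ((hasDerivAt_id x).prodMk (hasDerivAt_const x y))

lemma hasDerivAt_dy {f : ℝ × ℝ → ℝ} (hf : Differentiable ℝ f) (x y : ℝ) :
    HasDerivAt (fun t => f (x, t)) (dy f (x, y)) y :=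
  (hf (x, y)).hasFDerivAt.comp_hasDerivAt y ((hasDerivAt_const y x).prodMk (hasDerivAt_id y))

instance : IsProbabilityMeasure (volume.restrict (Set.Ioc (0 : ℝ) 1)) :=
  ⟨by simp⟩

lemma measurePreserving_shift (r : ℝ) :
    MeasurePreserving (fun p : ℝ × ℝ => (p.1 + r, p.2)) stripVol stripVol :=
  (measurePreserving_add_right volume r).prod (MeasurePreserving.id _)

lemma MeasureTheory.MemLp.shift {F : ℝ × ℝ → ℝ} (hF : MemLp F 2 stripVol) (r : ℝ) :
    MemLp (fun p : ℝ × ℝ => F (p.1 + r, p.2)) 2 stripVol :=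
  hF.comp_measurePreserving (measurePreserving_shift r)

/-- Correlations of square integrable functions are continuous in the shifts. -/
lemma continuous_correlation {F G : ℝ × ℝ → ℝ} (hF : MemLp F 2 stripVol)
    (hG : MemLp G 2 stripVol) :
    Continuous fun q : ℝ × ℝ =>
      ∫ p : ℝ × ℝ, F (p.1 + q.1, p.2) * G (p.1 + q.2, p.2) ∂stripVol := by
  let sh : ℝ → C(ℝ × ℝ, ℝ × ℝ) := fun r => ⟨fun p => (p.1 + r, p.2), by fun_prop⟩
  have hsh : Continuous sh := by
    have : Continuous (fun z : ℝ × (ℝ × ℝ) => (z.2.1 + z.1, z.2.2)) := by fun_prop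
    exact (ContinuousMap.mk _ this).curry.continuous
  have hT : ∀ {H : ℝ × ℝ → ℝ} (hH : MemLp H 2 stripVol), Continuous fun r =>
      Lp.compMeasurePreserving (sh r) (measurePreserving_shift r) hH.toLp := fun hH =>
    continuous_const.compMeasurePreservingLp hsh _ (by simp)
  have h := ((hT hG).comp continuous_snd).inner (𝕜 := ℝ) ((hT hF).comp continuous_fst)
  refine h.congr fun q => ?_
  rw [L2.inner_def]
  refine integral_congr_ae ?_
  have hc : ∀ {H : ℝ × ℝ → ℝ} (hH : MemLp H 2 stripVol) (r : ℝ),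
      (Lp.compMeasurePreserving (sh r) (measurePreserving_shift r) hH.toLp : ℝ × ℝ → ℝ)
        =ᵐ[stripVol] fun p => H (p.1 + r, p.2) := fun hH r => by
    refine (Lp.coeFn_compMeasurePreserving _ _).trans ?_
    exact (measurePreserving_shift r).quasiMeasurePreserving.ae_eq_comp hH.coeFn_toLp
  filter_upwards [hc hF q.1, hc hG q.2] with p h1 h2
  simp only [Function.comp_apply, h1, h2, RCLike.inner_apply, conj_trivial]

lemma memLp_slice_dy {F : ℝ × ℝ → ℝ} (hm : Measurable F) (hF : MemLp F 2 stripVol) :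
    ∀ᵐ x, MemLp (fun y => F (x, y)) 2 (volume.restrict (Set.Ioc (0 : ℝ) 1)) := by
  filter_upwards [hF.integrable_sq.prod_right_ae] with x hx
  exact (memLp_two_iff_integrable_sq
    (hm.comp measurable_prodMk_left).aestronglyMeasurable).2 hx

lemma memLp_slice_dx {F : ℝ × ℝ → ℝ} (hm : Measurable F) (hF : MemLp F 2 stripVol) :
    ∀ᵐ y ∂(volume.restrict (Set.Ioc (0 : ℝ) 1)), MemLp (fun x => F (x, y)) 2 volume := by
  filter_upwards [hF.integrable_sq.prod_left_ae] with y hy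
  exact (memLp_two_iff_integrable_sq
    (hm.comp measurable_prodMk_right).aestronglyMeasurable).2 hy

lemma MeasureTheory.MemLp.intervalIntegrable_two {φ : ℝ → ℝ} (h : MemLp φ 2 volume) (s t : ℝ) :
    IntervalIntegrable φ volume s t :=
  ((h.locallyIntegrable (by norm_num)).integrableOn_isCompact isCompact_uIcc).intervalIntegrable

lemma sub_eq_integral_dx {f : ℝ × ℝ → ℝ} (hf : Differentiable ℝ f)
    (h1 : MemLp (dx f) 2 stripVol) :
    ∀ᵐ y ∂(volume.restrict (Set.Ioc (0 : ℝ) 1)), ∀ s t,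
      f (t, y) - f (s, y) = ∫ x in s..t, dx f (x, y) := by
  filter_upwards [memLp_slice_dx (measurable_dx f) h1] with y hy s t
  exact (intervalIntegral.integral_eq_sub_of_hasDerivAt (fun x _ => hasDerivAt_dx hf x y)
    (hy.intervalIntegrable_two s t)).symm

lemma intervalIntegrable_of_memLp_slice {φ : ℝ → ℝ}
    (h : MemLp φ 2 (volume.restrict (Set.Ioc (0 : ℝ) 1))) : IntervalIntegrable φ volume 0 1 := by
  rw [intervalIntegrable_iff_integrableOn_Ioc_of_le zero_le_one]
  exact h.integrable (by norm_num)

lemma abs_integral_sq_le {φ : ℝ → ℝ} (h : MemLp φ 2 (volume.restrict (Set.Ioc (0 : ℝ) 1))) :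
    (∫ y in Set.Ioc (0 : ℝ) 1, |φ y|) ^ 2 ≤ ∫ y in Set.Ioc (0 : ℝ) 1, φ y ^ 2 := by
  set ν := volume.restrict (Set.Ioc (0 : ℝ) 1)
  set m := ∫ y, |φ y| ∂ν with hm
  have h1 : Integrable (fun y => |φ y|) ν := (h.integrable (by norm_num)).abs
  have h2 : Integrable (fun y => φ y ^ 2) ν := h.integrable_sq
  have h0 : 0 ≤ ∫ y, (φ y ^ 2 - 2 * m * |φ y| + m ^ 2) ∂ν := by
    refine integral_nonneg fun y => ?_
    have := sq_nonneg (|φ y| - m)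
    simp only [Pi.zero_apply]
    nlinarith [sq_abs (φ y)]
  have h3 : Integrable (fun y => φ y ^ 2 - 2 * m * |φ y|) ν := h2.sub (h1.const_mul _)
  rw [integral_add h3 (integrable_const _),
    integral_sub h2 (h1.const_mul _), integral_const_mul, integral_const] at h0
  simp only [probReal_univ, one_smul] at h0
  rw [← hm] at h0
  nlinarith

lemma abs_sub_le_integral_dy {f : ℝ × ℝ → ℝ} (hf : Differentiable ℝ f) {x : ℝ}
    (h : MemLp (fun y => dy f (x, y)) 2 (volume.restrict (Set.Ioc (0 : ℝ) 1))) {y : ℝ}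
    (hy : y ∈ Set.Ioc (0 : ℝ) 1) :
    |f (x, y) - f (x, 0)| ≤ ∫ y in Set.Ioc (0 : ℝ) 1, |dy f (x, y)| := by
  have hi := intervalIntegrable_of_memLp_slice h
  have hi' : IntervalIntegrable (fun y => dy f (x, y)) volume 0 y :=
    hi.mono_set (by
      rw [Set.uIcc_of_le hy.1.le, Set.uIcc_of_le zero_le_one]
      exact Set.Icc_subset_Icc_right hy.2)
  rw [← intervalIntegral.integral_eq_sub_of_hasDerivAt (fun t _ => hasDerivAt_dy hf x t) hi']
  refine (intervalIntegral.abs_integral_le_integral_abs hy.1.le).trans ?_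
  rw [intervalIntegral.integral_of_le hy.1.le]
  exact setIntegral_mono_set (h.integrable (by norm_num)).abs
    (ae_of_all _ fun t => abs_nonneg _)
    (Set.Ioc_subset_Ioc_right hy.2).eventuallyLE

/-- A square integrable, divergence-free gradient field on the strip, periodic in the second
variable. -/
structure StripField (f g : ℝ × ℝ → ℝ) : Prop where
  hf : Differentiable ℝ f
  hg : Differentiable ℝ g
  f_per : ∀ x, f (x, 1) = f (x, 0)
  g_per : ∀ x, g (x, 1) = g (x, 0)
  div_free : ∀ p, dx f p + dy g p = 0
  dx_f : MemLp (dx f) 2 stripVol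
  dy_f : MemLp (dy f) 2 stripVol
  dx_g : MemLp (dx g) 2 stripVol
  dy_g : MemLp (dy g) 2 stripVol

namespace StripField

variable {f g : ℝ × ℝ → ℝ}

lemma integrable_pairing (h : StripField f g) :
    Integrable fun x => ∫ y in Set.Ioc (0 : ℝ) 1, dy f (x, y) * g (x, y) := by
  have hgm := h.hg.continuous.measurable
  have hfm := measurable_dy f
  have hI : Integrable fun x => (∫ y in Set.Ioc (0 : ℝ) 1, dy f (x, y) ^ 2)
      + ∫ y in Set.Ioc (0 : ℝ) 1, dy g (x, y) ^ 2 :=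
    h.dy_f.integrable_sq.integral_prod_left.add h.dy_g.integrable_sq.integral_prod_left
  refine hI.mono' ?_ ?_
  · have : StronglyMeasurable fun p : ℝ × ℝ => dy f p * g p :=
      (hfm.mul hgm).stronglyMeasurable
    exact this.integral_prod_right'.aestronglyMeasurable
  filter_upwards [memLp_slice_dy hfm h.dy_f, memLp_slice_dy (measurable_dy g) h.dy_g]
    with x hx hx'
  set ν := volume.restrict (Set.Ioc (0 : ℝ) 1)
  have hfi : Integrable (fun y => dy f (x, y)) ν := hx.integrable (by norm_num)
  have hz : ∫ y, dy f (x, y) ∂ν = 0 := by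
    rw [← intervalIntegral.integral_of_le zero_le_one,
      intervalIntegral.integral_eq_sub_of_hasDerivAt (fun t _ => hasDerivAt_dy h.hf x t)
      (intervalIntegrable_of_memLp_slice hx), h.f_per, sub_self]
  set m := ∫ y, |dy g (x, y)| ∂ν with hm
  have hb : ∀ᵐ y ∂ν, ‖dy f (x, y) * (g (x, y) - g (x, 0))‖ ≤ |dy f (x, y)| * m := by
    filter_upwards [ae_restrict_mem measurableSet_Ioc] with y hy
    rw [norm_mul, Real.norm_eq_abs, Real.norm_eq_abs]
    exact mul_le_mul_of_nonneg_left (abs_sub_le_integral_dy h.hg hx' hy) (abs_nonneg _)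
  have hgx : Measurable fun y => g (x, y) := hgm.comp measurable_prodMk_left
  have hfx : Measurable fun y => dy f (x, y) := hfm.comp measurable_prodMk_left
  have hi : Integrable (fun y => dy f (x, y) * (g (x, y) - g (x, 0))) ν :=
    (hfi.abs.mul_const m).mono' (Measurable.aestronglyMeasurable (by fun_prop)) hb
  have he : ∫ y, dy f (x, y) * g (x, y) ∂ν = ∫ y, dy f (x, y) * (g (x, y) - g (x, 0)) ∂ν := by
    have : ∫ y, dy f (x, y) * g (x, y) ∂ν
        = ∫ y, (dy f (x, y) * (g (x, y) - g (x, 0)) + dy f (x, y) * g (x, 0)) ∂ν :=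
      integral_congr_ae (ae_of_all _ fun y => by simp only []; ring)
    rw [this, integral_add hi (hfi.mul_const _), integral_mul_const, hz]
    ring
  rw [he]
  refine (norm_integral_le_of_norm_le (hfi.abs.mul_const m) hb).trans ?_
  rw [integral_mul_const]
  have a1 := abs_integral_sq_le hx
  have a2 := abs_integral_sq_le hx'
  nlinarith [sq_nonneg ((∫ y, |dy f (x, y)| ∂ν) - m), sq_nonneg (∫ y, |dy f (x, y)| ∂ν),
    sq_nonneg m]

/-- Slice-wise integration by parts for the difference quotient of the pairing. -/
lemma slice_identity (h : StripField f g) (r : ℝ) :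
    ∀ᵐ x, ∫ y in Set.Ioc (0 : ℝ) 1, (dy f (x + r, y) * (g (x + r, y) - g (x, y))
        + (f (x + r, y) - f (x, y)) * dx f (x, y))
      = (∫ y in Set.Ioc (0 : ℝ) 1, dy f (x + r, y) * g (x + r, y))
        - ∫ y in Set.Ioc (0 : ℝ) 1, dy f (x, y) * g (x, y) := by
  have hshift : ∀ᵐ x : ℝ, MemLp (fun y => dy f (x + r, y)) 2
      (volume.restrict (Set.Ioc (0 : ℝ) 1)) :=
    (measurePreserving_add_right volume r).quasiMeasurePreserving.ae
      (memLp_slice_dy (measurable_dy f) h.dy_f)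
  filter_upwards [memLp_slice_dy (measurable_dy f) h.dy_f,
    memLp_slice_dy (measurable_dy g) h.dy_g, hshift] with x h1 h2 h3
  have i1 := intervalIntegrable_of_memLp_slice h1
  have i2 := intervalIntegrable_of_memLp_slice h2
  have i3 := intervalIntegrable_of_memLp_slice h3
  have cf : ∀ x, Continuous fun y => f (x, y) := fun x => h.hf.continuous.comp (by fun_prop)
  have cg : ∀ x, Continuous fun y => g (x, y) := fun x => h.hg.continuous.comp (by fun_prop)
  simp only [← intervalIntegral.integral_of_le (zero_le_one' ℝ)]
  have ibp := intervalIntegral.integral_mul_deriv_eq_deriv_mul (a := 0) (b := 1)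
    (fun y _ => (hasDerivAt_dy h.hf (x + r) y).sub (hasDerivAt_dy h.hf x y))
    (fun y _ => hasDerivAt_dy h.hg x y) (i3.sub i1) i2
  simp only [Pi.sub_apply, h.f_per, h.g_per, sub_self, zero_sub] at ibp
  have hd : ∀ y, dx f (x, y) = -dy g (x, y) := fun y => by linarith [h.div_free (x, y)]
  have j1 : IntervalIntegrable (fun y => dy f (x + r, y) * g (x + r, y)) volume 0 1 :=
    i3.mul_continuousOn (cg _).continuousOn
  have j2 : IntervalIntegrable (fun y => dy f (x, y) * g (x, y)) volume 0 1 :=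
    i1.mul_continuousOn (cg _).continuousOn
  have j3 : IntervalIntegrable (fun y => dy f (x + r, y) * g (x, y)) volume 0 1 :=
    i3.mul_continuousOn (cg _).continuousOn
  have j4 : IntervalIntegrable (fun y => (f (x + r, y) - f (x, y)) * dy g (x, y)) volume 0 1 :=
    i2.continuousOn_mul ((cf _).sub (cf _)).continuousOn
  have e1 : ∫ y in (0 : ℝ)..1, (dy f (x + r, y) * (g (x + r, y) - g (x, y))
        + (f (x + r, y) - f (x, y)) * dx f (x, y))
      = (∫ y in (0 : ℝ)..1, dy f (x + r, y) * g (x + r, y))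
        - (∫ y in (0 : ℝ)..1, dy f (x + r, y) * g (x, y))
        - ∫ y in (0 : ℝ)..1, (f (x + r, y) - f (x, y)) * dy g (x, y) := by
    rw [← intervalIntegral.integral_sub j1 j3, ← intervalIntegral.integral_sub (j1.sub j3) j4]
    refine intervalIntegral.integral_congr fun y _ => ?_
    simp only [hd]; ring
  have e2 : ∫ y in (0 : ℝ)..1, (dy f (x + r, y) - dy f (x, y)) * g (x, y)
      = (∫ y in (0 : ℝ)..1, dy f (x + r, y) * g (x, y))
        - ∫ y in (0 : ℝ)..1, dy f (x, y) * g (x, y) := by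
    rw [← intervalIntegral.integral_sub j3 j2]
    refine intervalIntegral.integral_congr fun y _ => ?_
    ring
  rw [e1, ibp, e2]
  ring

end StripField

lemma integrable_shift_mul_shift {F G : ℝ × ℝ → ℝ} (hF : MemLp F 2 stripVol)
    (hG : MemLp G 2 stripVol) (h : ℝ) (ρ : Measure ℝ) [IsFiniteMeasure ρ] :
    Integrable (fun z : ℝ × (ℝ × ℝ) => F (z.2.1 + h, z.2.2) * G (z.2.1 + z.1, z.2.2))
      (ρ.prod stripVol) := by
  have h1 : MemLp (fun z : ℝ × (ℝ × ℝ) => F (z.2.1 + h, z.2.2)) 2 (ρ.prod stripVol) :=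
    (hF.shift h).comp_snd ρ
  have hmp : MeasurePreserving (fun z : ℝ × (ℝ × ℝ) => (z.1, ((z.2.1 + z.1, z.2.2) : ℝ × ℝ)))
      (ρ.prod stripVol) (ρ.prod stripVol) :=
    (MeasurePreserving.id ρ).skew_product (g := fun r (p : ℝ × ℝ) => (p.1 + r, p.2)) (by fun_prop)
      (ae_of_all _ fun r => (measurePreserving_shift r).map_eq)
  have h2 : MemLp (fun z : ℝ × (ℝ × ℝ) => G (z.2.1 + z.1, z.2.2)) 2 (ρ.prod stripVol) :=
    (hG.comp_snd ρ).comp_measurePreserving hmp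
  exact h1.integrable_mul h2

namespace StripField

variable {f g : ℝ × ℝ → ℝ}

lemma integral_correlation_eq_zero (h : StripField f g) {r : ℝ} (hr : 0 < r) :
    ∫ s in (0 : ℝ)..r, ((∫ p : ℝ × ℝ, dy f (p.1 + r, p.2) * dx g (p.1 + s, p.2) ∂stripVol)
      + ∫ p : ℝ × ℝ, dx f (p.1 + 0, p.2) * dx f (p.1 + s, p.2) ∂stripVol) = 0 := by
  set ρ := volume.restrict (Set.Ioc 0 r) with hρ
  have i1 := integrable_shift_mul_shift h.dy_f h.dx_g r ρ
  have i2 := integrable_shift_mul_shift h.dx_f h.dx_f 0 ρ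
  have i3 := i1.add i2
  rw [intervalIntegral.integral_of_le hr.le]
  have e1 : ∫ s, ((∫ p : ℝ × ℝ, dy f (p.1 + r, p.2) * dx g (p.1 + s, p.2) ∂stripVol)
      + ∫ p : ℝ × ℝ, dx f (p.1 + 0, p.2) * dx f (p.1 + s, p.2) ∂stripVol) ∂ρ
      = ∫ s, ∫ p : ℝ × ℝ, (dy f (p.1 + r, p.2) * dx g (p.1 + s, p.2)
        + dx f (p.1 + 0, p.2) * dx f (p.1 + s, p.2)) ∂stripVol ∂ρ := by
    refine integral_congr_ae ?_
    filter_upwards [i1.prod_right_ae, i2.prod_right_ae] with s h1 h2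
    exact (integral_add h1 h2).symm
  rw [e1, integral_integral_swap i3]
  have e2 : ∀ᵐ p : ℝ × ℝ ∂stripVol, ∫ s, (dy f (p.1 + r, p.2) * dx g (p.1 + s, p.2)
        + dx f (p.1 + 0, p.2) * dx f (p.1 + s, p.2)) ∂ρ
      = dy f (p.1 + r, p.2) * (g (p.1 + r, p.2) - g (p.1, p.2))
        + (f (p.1 + r, p.2) - f (p.1, p.2)) * dx f (p.1, p.2) := by
    have a1 := Measure.quasiMeasurePreserving_snd (μ := (volume : Measure ℝ))
      |>.ae (sub_eq_integral_dx h.hf h.dx_f)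
    have a2 := Measure.quasiMeasurePreserving_snd (μ := (volume : Measure ℝ))
      |>.ae (sub_eq_integral_dx h.hg h.dx_g)
    have a3 := Measure.quasiMeasurePreserving_snd (μ := (volume : Measure ℝ))
      |>.ae (memLp_slice_dx (measurable_dx f) h.dx_f)
    have a4 := Measure.quasiMeasurePreserving_snd (μ := (volume : Measure ℝ))
      |>.ae (memLp_slice_dx (measurable_dx g) h.dx_g)
    filter_upwards [a1, a2, a3, a4] with p b1 b2 b3 b4
    have shift : ∀ φ : ℝ → ℝ, ∫ s in (0 : ℝ)..r, φ (p.1 + s) = ∫ x in p.1..(p.1 + r), φ x :=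
      fun φ => by rw [intervalIntegral.integral_comp_add_left φ, add_zero]
    have sh_i : ∀ φ : ℝ → ℝ, MemLp φ 2 volume →
        IntervalIntegrable (fun s => φ (p.1 + s)) volume 0 r := fun φ hφ =>
      (hφ.comp_measurePreserving (measurePreserving_add_left volume p.1)).intervalIntegrable_two
        0 r
    rw [hρ, ← intervalIntegral.integral_of_le hr.le, intervalIntegral.integral_add
      ((sh_i _ b4).const_mul _) ((sh_i _ b3).const_mul _),
      intervalIntegral.integral_const_mul, intervalIntegral.integral_const_mul,
      shift fun x => dx g (x, p.2), shift fun x => dx f (x, p.2), ← b1, ← b2, add_zero]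
    ring
  have i4 : Integrable (fun p : ℝ × ℝ => dy f (p.1 + r, p.2) * (g (p.1 + r, p.2) - g (p.1, p.2))
        + (f (p.1 + r, p.2) - f (p.1, p.2)) * dx f (p.1, p.2)) stripVol :=
    i3.integral_prod_right.congr e2
  rw [integral_congr_ae e2, integral_prod _ i4, integral_congr_ae (h.slice_identity r)]
  have hB := h.integrable_pairing
  rw [integral_sub (hB.comp_add_right r) hB, integral_add_right_eq_self
    (fun x => ∫ y in Set.Ioc (0 : ℝ) 1, dy f (x, y) * g (x, y)) r, sub_self]

/-- The Jacobian determinant of a periodic divergence-free field integrates to zero. -/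
theorem integral_det_eq_zero (h : StripField f g) :
    ∫ p, (dy f p * dx g p + dx f p ^ 2) ∂stripVol = 0 := by
  have c1 := continuous_correlation h.dy_f h.dx_g
  have c2 := continuous_correlation h.dx_f h.dx_f
  set C : ℝ × ℝ → ℝ := fun q =>
    (∫ p : ℝ × ℝ, dy f (p.1 + q.1, p.2) * dx g (p.1 + q.2, p.2) ∂stripVol)
      + ∫ p : ℝ × ℝ, dx f (p.1 + 0, p.2) * dx f (p.1 + q.2, p.2) ∂stripVol with hC
  have cC : Continuous C := c1.add
    (c2.comp (show Continuous fun q : ℝ × ℝ => ((0 : ℝ), q.2) by fun_prop))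
  have h0 : C (0, 0) = ∫ p, (dy f p * dx g p + dx f p ^ 2) ∂stripVol := by
    have i1 : Integrable (fun p => dy f p * dx g p) stripVol := h.dy_f.integrable_mul h.dx_g
    rw [integral_add i1 h.dx_f.integrable_sq]
    simp only [hC, add_zero, sq]
  rw [← h0]
  by_contra hne
  obtain ⟨δ, hδ, hball⟩ := Metric.continuousAt_iff.1 cC.continuousAt (|C (0, 0)|)
    (abs_pos.2 hne)
  have hr : 0 < δ / 2 := by positivity
  have hz : ∫ s in (0 : ℝ)..(δ / 2), C (δ / 2, s) = 0 := h.integral_correlation_eq_zero hr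
  have hcs : Continuous fun s => C (δ / 2, s) := cC.comp (by fun_prop)
  have hb : ∀ s ∈ Set.Icc 0 (δ / 2), |C (δ / 2, s) - C (0, 0)| < |C (0, 0)| := fun s hs => by
    rw [← Real.dist_eq]
    refine hball ?_
    rw [Prod.dist_eq, max_lt_iff, Real.dist_eq, Real.dist_eq, sub_zero, sub_zero,
      abs_of_pos hr, abs_of_nonneg hs.1]
    constructor <;> linarith [hs.2]
  have hpos : 0 < ∫ s in (0 : ℝ)..(δ / 2), C (0, 0) * C (δ / 2, s) := by
    refine intervalIntegral.intervalIntegral_pos_of_pos_on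
      ((continuous_const.mul hcs).intervalIntegrable _ _) (fun s hs => ?_) hr
    have h2 := hb s ⟨hs.1.le, hs.2.le⟩
    rw [← sq_lt_sq] at h2
    nlinarith [sq_nonneg (C (δ / 2, s))]
  rw [intervalIntegral.integral_const_mul, hz, mul_zero] at hpos
  exact lt_irrefl _ hpos

end StripField

lemma frequently_small_of_integrable {e : ℝ → ℝ} (he : Integrable e) {P : ℝ → Prop}
    (hP : ∀ᵐ t, P t) {ε : ℝ} (hε : 0 < ε) {s : Set ℝ} (hs : volume s = ∞) :
    ∃ t ∈ s, P t ∧ e t < ε := by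
  by_contra! hcon
  have h1 : volume s ≤ volume {t | ε ≤ e t} := by
    refine measure_mono_ae ?_
    filter_upwards [hP] with t ht hts
    exact hcon t hts ht
  exact absurd (h1.trans_lt (he.measure_ge_lt_top hε)) (by simp [hs])

/-- The first component of the calibrating vector field. -/
def flux (z w : ℝ) : ℝ := w * (1 - z ^ 2 - w ^ 2 / 3)

lemma hasFDerivAt_flux {f g : ℝ × ℝ → ℝ} (hf : Differentiable ℝ f) (hg : Differentiable ℝ g)
    (p : ℝ × ℝ) : HasFDerivAt (fun p => flux (f p) (g p))
      ((1 - f p ^ 2 - g p ^ 2) • fderiv ℝ g p - (2 * f p * g p) • fderiv ℝ f p) p := by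
  have h1 := (hf p).hasFDerivAt
  have h2 := (hg p).hasFDerivAt
  refine (h2.mul (((h1.pow 2).const_sub 1).sub ((h2.pow 2).mul_const (1 / 3)))).congr_fderiv ?_
    |>.congr_of_eventuallyEq (Eventually.of_forall fun q => ?_)
  · ext <;> simp <;> ring
  · change flux (f q) (g q) = g q * (1 - f q ^ 2 - g q ^ 2 * (1 / 3))
    unfold flux; ring

namespace StripField

variable {f g : ℝ × ℝ → ℝ}

lemma integral_flux (h : StripField f g)
    (hi : Integrable (fun p => (1 - f p ^ 2 - g p ^ 2) * (dx g p + dy f p)) stripVol) (s t : ℝ) :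
    ∫ x in s..t, ∫ y in (0 : ℝ)..1,
        (1 - f (x, y) ^ 2 - g (x, y) ^ 2) * (dx g (x, y) + dy f (x, y))
      = (∫ y in (0 : ℝ)..1, flux (f (t, y)) (g (t, y)))
        - ∫ y in (0 : ℝ)..1, flux (f (s, y)) (g (s, y)) := by
  have cF : Continuous fun p => flux (f p) (g p) := by
    have := h.hf.continuous; have := h.hg.continuous; unfold flux; fun_prop
  have cG : Continuous fun p => flux (g p) (f p) := by
    have := h.hf.continuous; have := h.hg.continuous; unfold flux; fun_prop
  have key : ∀ p, ((1 - f p ^ 2 - g p ^ 2) • fderiv ℝ g p - (2 * f p * g p) • fderiv ℝ f p) (1, 0)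
      + ((1 - g p ^ 2 - f p ^ 2) • fderiv ℝ f p - (2 * g p * f p) • fderiv ℝ g p) (0, 1)
      = (1 - f p ^ 2 - g p ^ 2) * (dx g p + dy f p) := fun p => by
    have := h.div_free p
    simp only [dx, dy, sub_apply, smul_apply,
      smul_eq_mul] at this ⊢
    linear_combination (-2 * f p * g p) * this
  have hio : IntegrableOn (fun p => (1 - f p ^ 2 - g p ^ 2) * (dx g p + dy f p))
      (Set.uIcc s t ×ˢ Set.uIcc 0 1) := by
    rw [Set.uIcc_of_le (zero_le_one' ℝ), IntegrableOn, Measure.volume_eq_prod,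
      ← Measure.prod_restrict, ← restrict_Ioc_eq_restrict_Icc]
    exact hi.mono_measure (Measure.prod_mono Measure.restrict_le_self le_rfl)
  have hdiv := integral2_divergence_prod_of_hasFDerivAt (fun p => flux (f p) (g p))
    (fun p => flux (g p) (f p)) _ _ s 0 t 1 cF.continuousOn cG.continuousOn
    (fun p _ => hasFDerivAt_flux h.hf h.hg p) (fun p _ => hasFDerivAt_flux h.hg h.hf p)
    (by simpa only [key] using hio)
  simp only [key, h.f_per, h.g_per] at hdiv
  rw [hdiv]; ring

end StripField

lemma abs_sub_mean_le {f : ℝ × ℝ → ℝ} (hf : Differentiable ℝ f) {x : ℝ}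
    (h : MemLp (fun y => dy f (x, y)) 2 (volume.restrict (Set.Ioc (0 : ℝ) 1))) {y : ℝ}
    (hy : y ∈ Set.Ioc (0 : ℝ) 1) :
    |f (x, y) - ∫ y in Set.Ioc (0 : ℝ) 1, f (x, y)|
      ≤ 2 * √(∫ y in Set.Ioc (0 : ℝ) 1, dy f (x, y) ^ 2) := by
  set m := ∫ y in Set.Ioc (0 : ℝ) 1, |dy f (x, y)| with hm
  have hms : m ≤ √(∫ y in Set.Ioc (0 : ℝ) 1, dy f (x, y) ^ 2) :=
    Real.le_sqrt_of_sq_le (abs_integral_sq_le h)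
  have hc : Continuous fun y => f (x, y) := hf.continuous.comp (by fun_prop)
  have hi : Integrable (fun y => f (x, y)) (volume.restrict (Set.Ioc (0 : ℝ) 1)) :=
    (hc.integrableOn_Icc (a := 0) (b := 1)).mono_set Set.Ioc_subset_Icc_self
  have h1 : |(∫ y in Set.Ioc (0 : ℝ) 1, f (x, y)) - f (x, 0)| ≤ m := by
    have e : (∫ y in Set.Ioc (0 : ℝ) 1, f (x, y)) - f (x, 0)
        = ∫ y in Set.Ioc (0 : ℝ) 1, (f (x, y) - f (x, 0)) := by
      rw [integral_sub hi (integrable_const _)]; simp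
    rw [e, ← Real.norm_eq_abs]
    refine (norm_integral_le_of_norm_le (integrable_const m) ?_).trans (by simp)
    filter_upwards [ae_restrict_mem measurableSet_Ioc] with y hy
    exact abs_sub_le_integral_dy hf h hy
  have h2 := abs_sub_le_integral_dy hf h hy
  rw [← hm] at h2
  rw [abs_le] at *
  constructor <;> linarith

lemma tendsto_integral_flux {f g : ℝ × ℝ → ℝ} (hf : Differentiable ℝ f)
    (hg : Differentiable ℝ g) {t : ℕ → ℝ} {z w : ℝ}
    (hfs : ∀ n, MemLp (fun y => dy f (t n, y)) 2 (volume.restrict (Set.Ioc (0 : ℝ) 1)))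
    (hgs : ∀ n, MemLp (fun y => dy g (t n, y)) 2 (volume.restrict (Set.Ioc (0 : ℝ) 1)))
    (hf0 : Tendsto (fun n => ∫ y in Set.Ioc (0 : ℝ) 1, dy f (t n, y) ^ 2) atTop (𝓝 0))
    (hg0 : Tendsto (fun n => ∫ y in Set.Ioc (0 : ℝ) 1, dy g (t n, y) ^ 2) atTop (𝓝 0))
    (hfm : Tendsto (fun n => ∫ y in Set.Ioc (0 : ℝ) 1, f (t n, y)) atTop (𝓝 z))
    (hgm : Tendsto (fun n => ∫ y in Set.Ioc (0 : ℝ) 1, g (t n, y)) atTop (𝓝 w)) :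
    Tendsto (fun n => ∫ y in Set.Ioc (0 : ℝ) 1, flux (f (t n, y)) (g (t n, y))) atTop
      (𝓝 (flux z w)) := by
  have aux : ∀ {f : ℝ × ℝ → ℝ} (hf : Differentiable ℝ f) {z : ℝ}
      (hfs : ∀ n, MemLp (fun y => dy f (t n, y)) 2 (volume.restrict (Set.Ioc (0 : ℝ) 1)))
      (hf0 : Tendsto (fun n => ∫ y in Set.Ioc (0 : ℝ) 1, dy f (t n, y) ^ 2) atTop (𝓝 0))
      (hfm : Tendsto (fun n => ∫ y in Set.Ioc (0 : ℝ) 1, f (t n, y)) atTop (𝓝 z)),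
      ∃ δ : ℕ → ℝ, Tendsto δ atTop (𝓝 0) ∧
        ∀ n, ∀ y ∈ Set.Ioc (0 : ℝ) 1, |f (t n, y) - z| ≤ δ n := by
    intro f hf z hfs hf0 hfm
    refine ⟨fun n => 2 * √(∫ y in Set.Ioc (0 : ℝ) 1, dy f (t n, y) ^ 2)
      + |(∫ y in Set.Ioc (0 : ℝ) 1, f (t n, y)) - z|, ?_, fun n y hy => ?_⟩
    · simpa using (hf0.sqrt.const_mul 2).add (hfm.sub_const z).abs
    · exact (abs_sub_le _ (∫ y in Set.Ioc (0 : ℝ) 1, f (t n, y)) _).trans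
        (add_le_add_left (abs_sub_mean_le hf (hfs n) hy) _)
  obtain ⟨δ, hδ, hδf⟩ := aux hf hfs hf0 hfm
  obtain ⟨η, hη, hηg⟩ := aux hg hgs hg0 hgm
  have hcf : Continuous fun q : ℝ × ℝ => flux q.1 q.2 := by unfold flux; fun_prop
  have hz : flux z w = ∫ y in Set.Ioc (0 : ℝ) 1, flux z w := by simp
  rw [hz]
  refine tendsto_integral_filter_of_dominated_convergence
    (fun _ => (|w| + 1) * (1 + (|z| + 1) ^ 2 + (|w| + 1) ^ 2))
    (Eventually.of_forall fun n => ?_) ?_ (integrable_const _) ?_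
  · have c1 : Continuous fun y => f (t n, y) := hf.continuous.comp (by fun_prop)
    have c2 : Continuous fun y => g (t n, y) := hg.continuous.comp (by fun_prop)
    exact (hcf.comp (c1.prodMk c2)).aestronglyMeasurable
  · filter_upwards [hδ.eventually (eventually_le_nhds one_pos),
      hη.eventually (eventually_le_nhds one_pos)] with n h1 h2
    filter_upwards [ae_restrict_mem measurableSet_Ioc] with y hy
    have b1 : |f (t n, y)| ≤ |z| + 1 := by
      have := abs_sub_abs_le_abs_sub (f (t n, y)) z
      linarith [hδf n y hy]
    have b2 : |g (t n, y)| ≤ |w| + 1 := by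
      have := abs_sub_abs_le_abs_sub (g (t n, y)) w
      linarith [hηg n y hy]
    have b1' : f (t n, y) ^ 2 ≤ (|z| + 1) ^ 2 := by
      rw [← sq_abs]; gcongr
    have b2' : g (t n, y) ^ 2 ≤ (|w| + 1) ^ 2 := by
      rw [← sq_abs]; gcongr
    rw [flux, norm_mul, Real.norm_eq_abs, Real.norm_eq_abs]
    refine mul_le_mul b2 ?_ (abs_nonneg _) (by positivity)
    rw [abs_le]
    constructor <;> nlinarith [sq_nonneg (f (t n, y)), sq_nonneg (g (t n, y))]
  · filter_upwards [ae_restrict_mem measurableSet_Ioc] with y hy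
    have l1 : Tendsto (fun n => f (t n, y)) atTop (𝓝 z) :=
      tendsto_iff_norm_sub_tendsto_zero.2
        (squeeze_zero (fun _ => norm_nonneg _) (fun n => hδf n y hy) hδ)
    have l2 : Tendsto (fun n => g (t n, y)) atTop (𝓝 w) :=
      tendsto_iff_norm_sub_tendsto_zero.2
        (squeeze_zero (fun _ => norm_nonneg _) (fun n => hηg n y hy) hη)
    exact (hcf.tendsto (z, w)).comp (l1.prodMk_nhds l2)

namespace StripField

variable {f g : ℝ × ℝ → ℝ}

lemma exists_seq_tendsto_flux (h : StripField f g) {l : Filter ℝ} {s : ℕ → Set ℝ}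
    (hs : ∀ n, volume (s n) = ∞) (hl : ∀ t : ℕ → ℝ, (∀ n, t n ∈ s n) → Tendsto t atTop l)
    {z w : ℝ} (hf : Tendsto (fun t => ∫ y in Set.Ioc (0 : ℝ) 1, f (t, y)) l (𝓝 z))
    (hg : Tendsto (fun t => ∫ y in Set.Ioc (0 : ℝ) 1, g (t, y)) l (𝓝 w)) :
    ∃ t : ℕ → ℝ, Tendsto t atTop l ∧
      Tendsto (fun n => ∫ y in Set.Ioc (0 : ℝ) 1, flux (f (t n, y)) (g (t n, y))) atTop
        (𝓝 (flux z w)) := by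
  have he : Integrable fun x => (∫ y in Set.Ioc (0 : ℝ) 1, dy f (x, y) ^ 2)
      + ∫ y in Set.Ioc (0 : ℝ) 1, dy g (x, y) ^ 2 :=
    h.dy_f.integrable_sq.integral_prod_left.add h.dy_g.integrable_sq.integral_prod_left
  have hP := (memLp_slice_dy (measurable_dy f) h.dy_f).and
    (memLp_slice_dy (measurable_dy g) h.dy_g)
  choose t ht htP hte using fun n : ℕ =>
    frequently_small_of_integrable he hP (ε := 1 / ((n : ℝ) + 1)) (by positivity) (hs n)
  have n1 : ∀ (F : ℝ × ℝ → ℝ) x, 0 ≤ ∫ y in Set.Ioc (0 : ℝ) 1, F (x, y) ^ 2 := fun F x =>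
    integral_nonneg fun y => sq_nonneg _
  have htl := hl t ht
  refine ⟨t, htl, tendsto_integral_flux h.hf h.hg (fun n => (htP n).1) (fun n => (htP n).2)
    ?_ ?_ (hf.comp htl) (hg.comp htl)⟩
  · exact squeeze_zero (fun n => n1 _ _) (fun n => by linarith [hte n, n1 (dy g) (t n)])
      tendsto_one_div_add_atTop_nhds_zero_nat
  · exact squeeze_zero (fun n => n1 _ _) (fun n => by linarith [hte n, n1 (dy f) (t n)])
      tendsto_one_div_add_atTop_nhds_zero_nat

lemma integral_calibration (h : StripField f g)
    (hi : Integrable (fun p => (1 - f p ^ 2 - g p ^ 2) * (dx g p + dy f p)) stripVol)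
    {z w z' w' : ℝ}
    (hf : Tendsto (fun t => ∫ y in Set.Ioc (0 : ℝ) 1, f (t, y)) atTop (𝓝 z))
    (hg : Tendsto (fun t => ∫ y in Set.Ioc (0 : ℝ) 1, g (t, y)) atTop (𝓝 w))
    (hf' : Tendsto (fun t => ∫ y in Set.Ioc (0 : ℝ) 1, f (t, y)) atBot (𝓝 z'))
    (hg' : Tendsto (fun t => ∫ y in Set.Ioc (0 : ℝ) 1, g (t, y)) atBot (𝓝 w')) :
    ∫ p, (1 - f p ^ 2 - g p ^ 2) * (dx g p + dy f p) ∂stripVol = flux z w - flux z' w' := by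
  obtain ⟨t, htl, ht⟩ := h.exists_seq_tendsto_flux (s := fun n => Set.Ioi (n : ℝ)) (by simp)
    (fun t ht => tendsto_atTop_mono (fun n => (ht n).le) tendsto_natCast_atTop_atTop) hf hg
  obtain ⟨r, hrl, hr⟩ := h.exists_seq_tendsto_flux (s := fun n => Set.Iio (-(n : ℝ))) (by simp)
    (fun t ht => tendsto_atBot_mono (fun n => (ht n).le)
      (tendsto_neg_atTop_atBot.comp tendsto_natCast_atTop_atTop)) hf' hg'
  rw [integral_prod _ hi]
  refine tendsto_nhds_unique (intervalIntegral_tendsto_integral hi.integral_prod_left hrl htl) ?_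
  refine (ht.sub hr).congr fun n => ?_
  have := h.integral_flux hi (r n) (t n)
  simp only [intervalIntegral.integral_of_le (zero_le_one' ℝ)] at this
  exact this.symm

/-- Fields whose energy does not exceed the calibrated value satisfy the first order system. -/
theorem system_of_energy_le (h : StripField f g) {a b : ℝ} (hab : a ^ 2 + b ^ 2 = 1)
    (hf : Tendsto (fun t => ∫ y in Set.Ioc (0 : ℝ) 1, f (t, y)) atTop (𝓝 a))
    (hg : Tendsto (fun t => ∫ y in Set.Ioc (0 : ℝ) 1, g (t, y)) atTop (𝓝 b))
    (hf' : Tendsto (fun t => ∫ y in Set.Ioc (0 : ℝ) 1, f (t, y)) atBot (𝓝 a))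
    (hg' : Tendsto (fun t => ∫ y in Set.Ioc (0 : ℝ) 1, g (t, y)) atBot (𝓝 (-b)))
    (hK : MemLp (fun p => 1 - f p ^ 2 - g p ^ 2) 2 stripVol)
    (hE : ∫ p, (1 / 2 * (dx f p ^ 2 + dx g p ^ 2 + (dy f p ^ 2 + dy g p ^ 2))
      + 1 / 2 * (1 - f p ^ 2 - g p ^ 2) ^ 2) ∂stripVol ≤ 4 * b ^ 3 / 3) :
    ∀ᵐ p ∂stripVol, dx f p = 0 ∧ dx g p + dy f p = 1 - f p ^ 2 - g p ^ 2 := by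
  have hi : Integrable (fun p => (1 - f p ^ 2 - g p ^ 2) * (dx g p + dy f p)) stripVol :=
    hK.integrable_mul (h.dx_g.add h.dy_f)
  have i1 := h.dx_f.integrable_sq
  have i2 := h.dx_g.integrable_sq
  have i3 := h.dy_f.integrable_sq
  have i4 := h.dy_g.integrable_sq
  have i5 := hK.integrable_sq
  have i6 : Integrable (fun p => dy f p * dx g p + dx f p ^ 2) stripVol :=
    (h.dy_f.integrable_mul h.dx_g).add i1
  have iE : Integrable (fun p => 1 / 2 * (dx f p ^ 2 + dx g p ^ 2 + (dy f p ^ 2 + dy g p ^ 2))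
      + 1 / 2 * (1 - f p ^ 2 - g p ^ 2) ^ 2) stripVol :=
    (((i1.add i2).add (i3.add i4)).const_mul _).add (i5.const_mul _)
  have hcal := h.integral_calibration hi hf hg hf' hg'
  have hflux : flux a b - flux a (-b) = 4 * b ^ 3 / 3 := by
    unfold flux; linear_combination (-2 * b) * hab
  have hdet := h.integral_det_eq_zero
  have hpt : ∀ p, 1 / 2 * (dx g p + dy f p - (1 - f p ^ 2 - g p ^ 2)) ^ 2 + 2 * dx f p ^ 2
      = (1 / 2 * (dx f p ^ 2 + dx g p ^ 2 + (dy f p ^ 2 + dy g p ^ 2))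
      + 1 / 2 * (1 - f p ^ 2 - g p ^ 2) ^ 2) - (1 - f p ^ 2 - g p ^ 2) * (dx g p + dy f p)
      + (dy f p * dx g p + dx f p ^ 2) := fun p => by
    have : dy g p = - dx f p := by linarith [h.div_free p]
    rw [this]; ring
  have iS : Integrable (fun p => 1 / 2 * (dx g p + dy f p - (1 - f p ^ 2 - g p ^ 2)) ^ 2
      + 2 * dx f p ^ 2) stripVol := by
    simp only [hpt]; exact (iE.sub hi).add i6
  have hz : ∫ p, (1 / 2 * (dx g p + dy f p - (1 - f p ^ 2 - g p ^ 2)) ^ 2 + 2 * dx f p ^ 2)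
      ∂stripVol = 0 := by
    refine le_antisymm ?_ (integral_nonneg fun p => by positivity)
    simp only [hpt]
    have iEi : Integrable (fun p => (1 / 2 * (dx f p ^ 2 + dx g p ^ 2 + (dy f p ^ 2 + dy g p ^ 2))
      + 1 / 2 * (1 - f p ^ 2 - g p ^ 2) ^ 2) - (1 - f p ^ 2 - g p ^ 2) * (dx g p + dy f p))
      stripVol := iE.sub hi
    rw [integral_add iEi i6, integral_sub iE hi]
    linarith
  rw [integral_eq_zero_iff_of_nonneg (fun p => by positivity) iS] at hz
  filter_upwards [hz] with p hp
  simp only [Pi.zero_apply] at hp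
  have h1 := sq_nonneg (dx g p + dy f p - (1 - f p ^ 2 - g p ^ 2))
  have h2 := sq_nonneg (dx f p)
  have s1 : (dx g p + dy f p - (1 - f p ^ 2 - g p ^ 2)) ^ 2 = 0 := by linarith
  have s2 : dx f p ^ 2 = 0 := by linarith
  exact ⟨pow_eq_zero_iff two_ne_zero |>.1 s2,
    sub_eq_zero.1 (pow_eq_zero_iff two_ne_zero |>.1 s1)⟩

end StripField

end Strip

section Rigidity

lemma eq_zero_of_periodic_of_ae {φ : ℝ → ℝ} (hφ : Continuous φ) (hp : Function.Periodic φ 1)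
    (h0 : ∀ᵐ y ∂(volume.restrict (Set.Ioc (0 : ℝ) 1)), φ y = 0) (y : ℝ) : φ y = 0 := by
  have h1 : Set.EqOn φ (fun _ => 0) (Set.Ioc 0 1) :=
    Measure.eqOn_Ioc_of_ae_eq volume h0 hφ.continuousOn continuousOn_const
  obtain ⟨z, hz, hyz⟩ := hp.exists_mem_Ioc one_pos y 0
  rw [hyz]
  exact h1 (by simpa using hz)

/-- A periodic solution of an autonomous scalar equation `ψ' = k - ψ²` is constant. -/
lemma periodic_ode_constant {ψ ψ' : ℝ → ℝ} {k : ℝ} (hψ : ∀ y, HasDerivAt ψ (ψ' y) y)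
    (hp : Function.Periodic ψ 1)
    (hode : ∀ᵐ y ∂(volume.restrict (Set.Ioc (0 : ℝ) 1)), ψ' y = k - ψ y ^ 2) :
    ∀ y, ψ y = ψ 0 ∧ ψ y ^ 2 = k := by
  have hc : Continuous ψ := continuous_iff_continuousAt.2 fun y => (hψ y).continuousAt
  have hcs : Continuous fun y => (k - ψ y ^ 2) ^ 2 := by fun_prop
  have hae : ∀ᵐ y, y ∈ Set.uIoc (0 : ℝ) 1 → (k - ψ y ^ 2) * ψ' y = (k - ψ y ^ 2) ^ 2 := by
    rw [Set.uIoc_of_le zero_le_one]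
    filter_upwards [(ae_restrict_iff' measurableSet_Ioc).1 hode] with y hy hm
    rw [hy hm]; ring
  have hae' : (fun y => (k - ψ y ^ 2) ^ 2) =ᵐ[volume.restrict (Set.uIoc (0 : ℝ) 1)]
      fun y => (k - ψ y ^ 2) * ψ' y := by
    rw [EventuallyEq, ae_restrict_iff' measurableSet_uIoc]
    filter_upwards [hae] with y hy hm using (hy hm).symm
  have hP : ∀ y, HasDerivAt (fun y => k * ψ y - ψ y ^ 3 / 3) ((k - ψ y ^ 2) * ψ' y) y := fun y => by
    refine (((hψ y).const_mul k).fun_sub (((hψ y).fun_pow 3).div_const 3)).congr_deriv ?_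
    push_cast; ring
  have hI := intervalIntegral.integral_eq_sub_of_hasDerivAt (fun y _ => hP y)
    ((hcs.intervalIntegrable 0 1).congr_ae hae')
  have h10 : ψ 1 = ψ 0 := by simpa using hp 0
  rw [intervalIntegral.integral_congr_ae hae, h10, sub_self,
    intervalIntegral.integral_eq_zero_iff_of_le_of_nonneg_ae zero_le_one
      (Eventually.of_forall fun y => sq_nonneg _) (hcs.intervalIntegrable 0 1)] at hI
  have hsq : ∀ y, k - ψ y ^ 2 = 0 := eq_zero_of_periodic_of_ae (by fun_prop)
    (fun y => by simp [hp y]) (hI.mono fun y hy => by simpa using hy)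
  refine fun y => ⟨?_, by linarith [hsq y]⟩
  have h0 : ∀ᵐ y, y ∈ Set.Ioc (0 : ℝ) 1 → ψ' y = 0 := by
    filter_upwards [(ae_restrict_iff' measurableSet_Ioc).1 hode] with y hy hm
    rw [hy hm, hsq]
  refine sub_eq_zero.1 (eq_zero_of_periodic_of_ae (φ := fun y => ψ y - ψ 0) (by fun_prop)
    (fun y => by simp [hp y]) ?_ y)
  refine (ae_restrict_iff' measurableSet_Ioc).2 (Eventually.of_forall fun z hz => ?_)
  have hz0 : ∀ᵐ y, y ∈ Set.uIoc (0 : ℝ) z → ψ' y = 0 := by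
    rw [Set.uIoc_of_le hz.1.le]
    filter_upwards [h0] with y hy hm using hy ⟨hm.1, hm.2.trans hz.2⟩
  have hz0' : (fun _ => (0 : ℝ)) =ᵐ[volume.restrict (Set.uIoc (0 : ℝ) z)] ψ' := by
    rw [EventuallyEq, ae_restrict_iff' measurableSet_uIoc]
    filter_upwards [hz0] with y hy hm using (hy hm).symm
  rw [← intervalIntegral.integral_eq_sub_of_hasDerivAt (fun y _ => hψ y)
    (IntervalIntegrable.congr_ae (by simp) hz0'), intervalIntegral.integral_congr_ae hz0]
  simp

variable {f g : ℝ × ℝ → ℝ}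

/-- Periodic solutions of the first order system are one-dimensional layers. -/
theorem StripField.eq_layer (h : StripField f g)
    (hfp : ∀ x y, f (x, y + 1) = f (x, y)) {a b : ℝ} (hb : 0 < b) (hab : a ^ 2 + b ^ 2 = 1)
    (hf : Tendsto (fun t => ∫ y in Set.Ioc (0 : ℝ) 1, f (t, y)) atTop (𝓝 a))
    (hg : Tendsto (fun t => ∫ y in Set.Ioc (0 : ℝ) 1, g (t, y)) atTop (𝓝 b))
    (hg' : Tendsto (fun t => ∫ y in Set.Ioc (0 : ℝ) 1, g (t, y)) atBot (𝓝 (-b)))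
    (hsys : ∀ᵐ p ∂stripVol, dx f p = 0 ∧ dx g p + dy f p = 1 - f p ^ 2 - g p ^ 2) :
    ∃ τ, ∀ x y, f (x, y) = a ∧ g (x, y) = layer b (x + τ) := by
  have hcf := h.hf.continuous
  have hs1 : ∀ᵐ y ∂(volume.restrict (Set.Ioc (0 : ℝ) 1)), ∀ᵐ x : ℝ,
      dx f (x, y) = 0 ∧ dx g (x, y) + dy f (x, y) = 1 - f (x, y) ^ 2 - g (x, y) ^ 2 :=
    Measure.ae_ae_of_ae_prod (Measure.measurePreserving_swap.quasiMeasurePreserving.ae hsys)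
  have hfx : ∀ t y, f (t, y) = f (0, y) := fun t y => by
    refine sub_eq_zero.1 (eq_zero_of_periodic_of_ae (φ := fun y => f (t, y) - f (0, y))
      (by fun_prop) (fun y => by simp [hfp]) ?_ y)
    filter_upwards [hs1, sub_eq_integral_dx h.hf h.dx_f] with y hy1 hy2
    rw [hy2, intervalIntegral.integral_congr_ae (g := fun _ => 0)
      (hy1.mono fun x hx _ => hx.1)]
    simp
  have hdx : ∀ x y, dx f (x, y) = 0 := fun x y => by
    have h1 := hasDerivAt_dx h.hf x y
    simp only [hfx _ y] at h1
    exact h1.unique (hasDerivAt_const _ _)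
  have hgy : ∀ x y, g (x, y) = g (x, 0) := fun x y => by
    refine is_const_of_deriv_eq_zero (f := fun t => g (x, t))
      (fun t => (hasDerivAt_dy h.hg x t).differentiableAt) (fun t => ?_) y 0
    rw [(hasDerivAt_dy h.hg x t).deriv]
    linarith [h.div_free (x, t), hdx x t]
  have hdg : ∀ x y, dx g (x, y) = dx g (x, 0) := fun x y => by
    have h1 := hasDerivAt_dx h.hg x y
    simp only [hgy _ y] at h1
    exact h1.unique (hasDerivAt_dx h.hg x 0)
  have hdf : ∀ x y, dy f (x, y) = dy f (0, y) := fun x y => by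
    have h1 := hasDerivAt_dy h.hf x y
    simp only [hfx x] at h1
    exact h1.unique (hasDerivAt_dy h.hf 0 y)
  have hs2 : ∀ᵐ y ∂(volume.restrict (Set.Ioc (0 : ℝ) 1)), ∀ᵐ x : ℝ,
      dx g (x, 0) + dy f (0, y) = 1 - f (0, y) ^ 2 - g (x, 0) ^ 2 := by
    filter_upwards [hs1] with y hy
    filter_upwards [hy] with x hx
    rw [← hdg x y, ← hdf x y, ← hfx x y, ← hgy x y]
    exact hx.2
  obtain ⟨y₀, hy₀⟩ := hs2.exists
  set k := f (0, y₀) ^ 2 + dy f (0, y₀) with hk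
  have hφ : ∀ x, dx g (x, 0) = 1 - k - g (x, 0) ^ 2 :=
    deriv_eq_of_ae_eq_continuous (fun x => hasDerivAt_dx h.hg x 0)
      (by have := h.hg.continuous; fun_prop) (hy₀.mono fun x hx => by
        change dx g (x, 0) = 1 - k - g (x, 0) ^ 2
        linarith)
  have hψ : ∀ᵐ y ∂(volume.restrict (Set.Ioc (0 : ℝ) 1)), dy f (0, y) = k - f (0, y) ^ 2 := by
    filter_upwards [hs2] with y hy
    obtain ⟨x, hx⟩ := hy.exists
    linarith [hφ x]
  have hψc := periodic_ode_constant (fun y => hasDerivAt_dy h.hf 0 y) (fun y => hfp 0 y) hψ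
  have hfc : ∀ x y, f (x, y) = f (0, 0) := fun x y => (hfx x y).trans (hψc y).1
  simp only [hfc] at hf
  have hfa : f (0, 0) = a := by simpa using hf
  simp only [hgy _ _] at hg hg'
  have hkb : 1 - k = b ^ 2 := by rw [← (hψc 0).2, hfa]; linarith
  obtain ⟨τ, hτ⟩ := eq_layer_of_ode (φ := fun x => g (x, 0)) hb
    (fun t => by
      have h1 := hasDerivAt_dx h.hg t 0
      rwa [hφ t, hkb] at h1)
    (by simpa using hg') (by simpa using hg)
  exact ⟨τ, fun x y => ⟨(hfc x y).trans hfa, (hgy x y).trans (hτ x)⟩⟩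

end Rigidity

section Plane

/-- Coordinates of a planar vector field, as functions on the product `ℝ × ℝ`. -/
def planar (u : (Fin 2 → ℝ) → Fin 2 → ℝ) (i : Fin 2) (p : ℝ × ℝ) : ℝ := u ![p.1, p.2] i

lemma hasFDerivAt_pair (p : ℝ × ℝ) :
    HasFDerivAt (fun p : ℝ × ℝ => ![p.1, p.2])
      ((ContinuousLinearEquiv.finTwoArrow ℝ ℝ).symm : ℝ × ℝ →L[ℝ] Fin 2 → ℝ) p :=
  (ContinuousLinearEquiv.finTwoArrow ℝ ℝ).symm.hasFDerivAt

variable {u : (Fin 2 → ℝ) → Fin 2 → ℝ}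

lemma hasFDerivAt_planar (hu : Differentiable ℝ u) (i : Fin 2) (p : ℝ × ℝ) :
    HasFDerivAt (planar u i) (((ContinuousLinearMap.proj i).comp (fderiv ℝ u ![p.1, p.2])).comp
      ((ContinuousLinearEquiv.finTwoArrow ℝ ℝ).symm : ℝ × ℝ →L[ℝ] Fin 2 → ℝ)) p :=
  HasFDerivAt.comp (g := fun x => u x i) p
    (hasFDerivAt_pi'.1 (hu ![p.1, p.2]).hasFDerivAt i) (hasFDerivAt_pair p)

lemma dx_planar (hu : Differentiable ℝ u) (i : Fin 2) (p : ℝ × ℝ) :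
    dx (planar u i) p = pd 0 u ![p.1, p.2] i := by
  have : ![(1 : ℝ), 0] = Pi.single 0 1 := by ext j; fin_cases j <;> simp
  simp [dx, pd, (hasFDerivAt_planar hu i p).fderiv, this]

lemma dy_planar (hu : Differentiable ℝ u) (i : Fin 2) (p : ℝ × ℝ) :
    dy (planar u i) p = pd 1 u ![p.1, p.2] i := by
  have : ![(0 : ℝ), 1] = Pi.single 1 1 := by ext j; fin_cases j <;> simp
  simp [dy, pd, (hasFDerivAt_planar hu i p).fderiv, this]

lemma measurableEmbedding_pair : MeasurableEmbedding fun p : ℝ × ℝ => ![p.1, p.2] :=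
  (MeasurableEquiv.finTwoArrow (α := ℝ)).symm.measurableEmbedding

lemma measurePreserving_pair : MeasurePreserving (fun p : ℝ × ℝ => ![p.1, p.2]) :=
  (volume_preserving_finTwoArrow ℝ).symm

lemma measurePreserving_strip :
    MeasurePreserving (fun p : ℝ × ℝ => ![p.1, p.2]) stripVol (volume.restrict (strip 2)) := by
  have h := measurePreserving_pair.restrict_preimage_emb measurableEmbedding_pair (strip 2)
  have hs : (fun p : ℝ × ℝ => ![p.1, p.2]) ⁻¹' strip 2 = Set.univ ×ˢ Set.Ico 0 1 := by
    ext p; simp [strip]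
  rwa [hs, Measure.volume_eq_prod, ← Measure.prod_restrict, Measure.restrict_univ,
    restrict_Ico_eq_restrict_Ioc] at h

lemma measurePreserving_cube :
    MeasurePreserving (fun p : ℝ × ℝ => ![p.1, p.2])
      ((volume.restrict (Set.Ioc 0 1)).prod (volume.restrict (Set.Ioc 0 1)))
      (volume.restrict (cube 2)) := by
  have h := measurePreserving_pair.restrict_preimage_emb measurableEmbedding_pair (cube 2)
  have hs : (fun p : ℝ × ℝ => ![p.1, p.2]) ⁻¹' cube 2 = Set.Ico 0 1 ×ˢ Set.Ico 0 1 := by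
    ext p; simp [cube]
  rwa [hs, Measure.volume_eq_prod, ← Measure.prod_restrict,
    restrict_Ico_eq_restrict_Ioc] at h

lemma avg_apply (hu : Continuous u) (t : ℝ) (i : Fin 2) :
    avg u t i = ∫ y in Set.Ioc (0 : ℝ) 1, planar u i (t, y) := by
  have hc : Continuous fun y : Fin 2 → ℝ => u (Function.update y 0 t) :=
    hu.comp (continuous_id.update 0 continuous_const)
  have hi : ∀ i, IntegrableOn (fun y => u (Function.update y 0 t) i) (cube 2) := fun i =>
    (((continuous_apply i).comp hc).continuousOn.integrableOn_compact
      (isCompact_univ_pi fun _ : Fin 2 => isCompact_Icc (a := (0 : ℝ)) (b := 1))).mono_set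
      (Set.pi_mono fun _ _ => Set.Ico_subset_Icc_self)
  have hup : ∀ p : ℝ × ℝ, u (Function.update ![p.1, p.2] 0 t) i = planar u i (t, p.2) :=
    fun p => by
      have : Function.update ![p.1, p.2] 0 t = ![t, p.2] := by ext j; fin_cases j <;> simp
      rw [this, planar]
  rw [avg, eval_integral hi, ← measurePreserving_cube.integral_comp measurableEmbedding_pair]
  simp only [hup]
  rw [integral_fun_snd (μ := volume.restrict (Set.Ioc (0 : ℝ) 1))
    (ν := volume.restrict (Set.Ioc (0 : ℝ) 1)) (fun y => planar u i (t, y))]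
  simp

lemma gradSq_pair (hu : Differentiable ℝ u) (p : ℝ × ℝ) :
    gradSq u ![p.1, p.2] = dx (planar u 0) p ^ 2 + dx (planar u 1) p ^ 2
      + (dy (planar u 0) p ^ 2 + dy (planar u 1) p ^ 2) := by
  simp [gradSq, dx_planar hu, dy_planar hu]

lemma Adm.integrable_gradSq (h : Adm 2 u) :
    Integrable (fun p => dx (planar u 0) p ^ 2 + dx (planar u 1) p ^ 2
      + (dy (planar u 0) p ^ 2 + dy (planar u 1) p ^ 2)) stripVol := by
  simp only [← gradSq_pair h.1]
  exact (measurePreserving_strip.integrable_comp_emb measurableEmbedding_pair).2 h.2.2.2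

lemma Adm.planar_add_one (h : Adm 2 u) (i : Fin 2) (x y : ℝ) :
    planar u i (x, y + 1) = planar u i (x, y) := by
  have h1 := h.2.1 ![x, y] 1 (by simp)
  have h2 : ![x, y] + Pi.single 1 1 = ![x, y + 1] := by ext j; fin_cases j <;> simp
  rw [h2] at h1
  simp [planar, h1]

lemma Adm.stripField (h : Adm 2 u) : StripField (planar u 0) (planar u 1) := by
  have hd : ∀ i, Differentiable ℝ (planar u i) := fun i p =>
    (hasFDerivAt_planar h.1 i p).differentiableAt
  have key : ∀ F : ℝ × ℝ → ℝ, Measurable F → (∀ p, F p ^ 2 ≤ dx (planar u 0) p ^ 2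
      + dx (planar u 1) p ^ 2 + (dy (planar u 0) p ^ 2 + dy (planar u 1) p ^ 2)) →
      MemLp F 2 stripVol := fun F hF hle =>
    (memLp_two_iff_integrable_sq hF.aestronglyMeasurable).2
      (h.integrable_gradSq.mono' (hF.pow_const 2).aestronglyMeasurable
        (Eventually.of_forall fun p => by simpa using hle p))
  refine ⟨hd 0, hd 1, fun x => ?_, fun x => ?_, fun p => ?_, key _ (measurable_dx _) ?_,
    key _ (measurable_dy _) ?_, key _ (measurable_dx _) ?_, key _ (measurable_dy _) ?_⟩
  · simpa using h.planar_add_one 0 x 0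
  · simpa using h.planar_add_one 1 x 0
  · rw [dx_planar h.1, dy_planar h.1]
    simpa using h.2.2.1 ![p.1, p.2]
  all_goals intro p; nlinarith [sq_nonneg (dx (planar u 0) p), sq_nonneg (dx (planar u 1) p),
    sq_nonneg (dy (planar u 0) p), sq_nonneg (dy (planar u 1) p)]

lemma energy_eq_lintegral_stripVol {W : (Fin 2 → ℝ) → ℝ}
    (hW : ∀ z, W z = (1 / 2) * (1 - (z 0 ^ 2 + z 1 ^ 2)) ^ 2) (hu : Differentiable ℝ u) :
    energy 2 W u = ∫⁻ p, ENNReal.ofReal (1 / 2 * (dx (planar u 0) p ^ 2 + dx (planar u 1) p ^ 2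
      + (dy (planar u 0) p ^ 2 + dy (planar u 1) p ^ 2))
      + 1 / 2 * (1 - planar u 0 p ^ 2 - planar u 1 p ^ 2) ^ 2) ∂stripVol := by
  rw [energy, ← measurePreserving_strip.lintegral_comp_emb measurableEmbedding_pair]
  refine lintegral_congr fun p => ?_
  rw [eden, gradSq_pair hu, hW, sub_sub]
  rfl

/-- Admissible fields with small energy are one-dimensional layers. -/
theorem Adm.eq_layer_of_energy_le {W : (Fin 2 → ℝ) → ℝ}
    (hW : ∀ z, W z = (1 / 2) * (1 - (z 0 ^ 2 + z 1 ^ 2)) ^ 2) (h : Adm 2 u) {a b : ℝ}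
    (hb : 0 < b) (hab : a ^ 2 + b ^ 2 = 1) (hbc : BdryCond 2 u ![a, -b] ![a, b])
    (hE : energy 2 W u ≤ ENNReal.ofReal (4 * b ^ 3 / 3)) :
    ∃ τ, ∀ x, u x = ![a, layer b (x 0 + τ)] := by
  rw [energy_eq_lintegral_stripVol hW h.1] at hE
  have hs := h.stripField
  have hm := tendsto_pi_nhds.1 hbc.1
  have hp := tendsto_pi_nhds.1 hbc.2
  simp only [avg_apply h.1.continuous] at hm hp
  have hcf := hs.hf.continuous
  have hcg := hs.hg.continuous
  have hcont : Continuous fun p => 1 - planar u 0 p ^ 2 - planar u 1 p ^ 2 := by fun_prop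
  have hmeas : Measurable fun p => 1 / 2 * (dx (planar u 0) p ^ 2 + dx (planar u 1) p ^ 2
      + (dy (planar u 0) p ^ 2 + dy (planar u 1) p ^ 2))
      + 1 / 2 * (1 - planar u 0 p ^ 2 - planar u 1 p ^ 2) ^ 2 := by
    have h1 := measurable_dx (planar u 0)
    have h2 := measurable_dx (planar u 1)
    have h3 := measurable_dy (planar u 0)
    have h4 := measurable_dy (planar u 1)
    have h5 := hcont.measurable
    fun_prop
  have hnn : ∀ p, 0 ≤ 1 / 2 * (dx (planar u 0) p ^ 2 + dx (planar u 1) p ^ 2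
      + (dy (planar u 0) p ^ 2 + dy (planar u 1) p ^ 2))
      + 1 / 2 * (1 - planar u 0 p ^ 2 - planar u 1 p ^ 2) ^ 2 := fun p => by positivity
  have hInt : Integrable (fun p => 1 / 2 * (dx (planar u 0) p ^ 2 + dx (planar u 1) p ^ 2
      + (dy (planar u 0) p ^ 2 + dy (planar u 1) p ^ 2))
      + 1 / 2 * (1 - planar u 0 p ^ 2 - planar u 1 p ^ 2) ^ 2) stripVol :=
    (lintegral_ofReal_ne_top_iff_integrable hmeas.aestronglyMeasurable
      (Eventually.of_forall hnn)).1 (hE.trans_lt ENNReal.ofReal_lt_top).ne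
  have hK : MemLp (fun p => 1 - planar u 0 p ^ 2 - planar u 1 p ^ 2) 2 stripVol :=
    (memLp_two_iff_integrable_sq hcont.aestronglyMeasurable).2
      ((hInt.const_mul 2).mono' (by fun_prop) (Eventually.of_forall fun p => by
        rw [Real.norm_of_nonneg (sq_nonneg _)]
        nlinarith [sq_nonneg (dx (planar u 0) p), sq_nonneg (dx (planar u 1) p),
          sq_nonneg (dy (planar u 0) p), sq_nonneg (dy (planar u 1) p)]))
  have hE' := ENNReal.toReal_le_of_le_ofReal (by positivity) hE
  rw [← integral_eq_lintegral_of_nonneg_ae (Eventually.of_forall hnn)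
    hmeas.aestronglyMeasurable] at hE'
  have hsys := hs.system_of_energy_le hab (by simpa using hp 0) (by simpa using hp 1)
    (by simpa using hm 0) (by simpa using hm 1) hK hE'
  obtain ⟨τ, hτ⟩ := hs.eq_layer (h.planar_add_one 0) hb hab (by simpa using hp 0)
    (by simpa using hp 1) (by simpa using hm 1) hsys
  refine ⟨τ, fun x => ?_⟩
  have hx : ![x 0, x 1] = x := by ext j; fin_cases j <;> rfl
  have h0 := (hτ (x 0) (x 1)).1
  have h1 := (hτ (x 0) (x 1)).2
  simp only [planar, hx] at h0 h1
  ext j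
  fin_cases j
  · exact h0
  · exact h1

lemma hasFDerivAt_layerField (a b : ℝ) (x : Fin 2 → ℝ) :
    HasFDerivAt (fun x : Fin 2 → ℝ => ![a, layer b (x 0)])
      (ContinuousLinearMap.pi ![0, (b ^ 2 - layer b (x 0) ^ 2) •
        (ContinuousLinearMap.proj 0 : (Fin 2 → ℝ) →L[ℝ] ℝ)]) x := by
  refine hasFDerivAt_pi.2 fun i => ?_
  fin_cases i
  · exact hasFDerivAt_const a x
  · exact HasDerivAt.comp_hasFDerivAt (f := fun x : Fin 2 → ℝ => x 0) x
      (hasDerivAt_layer b (x 0)) (hasFDerivAt_apply 0 x)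

lemma gradSq_layerField (a b : ℝ) (x : Fin 2 → ℝ) :
    gradSq (fun x : Fin 2 → ℝ => ![a, layer b (x 0)]) x = (b ^ 2 - layer b (x 0) ^ 2) ^ 2 := by
  simp [gradSq, pd, (hasFDerivAt_layerField a b x).fderiv]

lemma measurePreserving_strip_fst :
    MeasurePreserving (fun x : Fin 2 → ℝ => x 0) (volume.restrict (strip 2)) volume := by
  have h : MeasurePreserving Prod.fst stripVol volume := measurePreserving_fst
  refine ⟨measurable_pi_apply 0, ?_⟩
  rw [← measurePreserving_strip.map_eq, Measure.map_map (measurable_pi_apply 0)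
    measurableEmbedding_pair.measurable]
  exact h.map_eq

lemma adm_layerField {b : ℝ} (hb : 0 < b) (a : ℝ) :
    Adm 2 fun x : Fin 2 → ℝ => ![a, layer b (x 0)] := by
  refine ⟨fun x => (hasFDerivAt_layerField a b x).differentiableAt, fun x i hi => ?_,
    fun x => ?_, ?_⟩
  · simp [Pi.single_eq_of_ne hi.symm]
  · simp [pd, (hasFDerivAt_layerField a b x).fderiv]
  · rw [IntegrableOn, funext (gradSq_layerField a b)]
    exact measurePreserving_strip_fst.integrable_comp_of_integrable (integrable_layer_deriv_sq hb)

lemma avg_layerField (a b t : ℝ) :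
    avg (fun x : Fin 2 → ℝ => ![a, layer b (x 0)]) t = ![a, layer b t] := by
  have hc : Continuous fun x : Fin 2 → ℝ => ![a, layer b (x 0)] :=
    continuous_iff_continuousAt.2 fun x => (hasFDerivAt_layerField a b x).continuousAt
  ext i
  rw [avg_apply hc]
  simp [planar]

lemma tendsto_layerCurve_atTop {b : ℝ} (hb : 0 < b) (a : ℝ) :
    Tendsto (fun t => ![a, layer b t]) atTop (𝓝 ![a, b]) :=
  tendsto_pi_nhds.2 fun i => by
    fin_cases i
    · exact tendsto_const_nhds
    · exact tendsto_layer_atTop hb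

lemma tendsto_layerCurve_atBot {b : ℝ} (hb : 0 < b) (a : ℝ) :
    Tendsto (fun t => ![a, layer b t]) atBot (𝓝 ![a, -b]) :=
  tendsto_pi_nhds.2 fun i => by
    fin_cases i
    · exact tendsto_const_nhds
    · exact tendsto_layer_atBot hb

lemma bdryCond_layerField {b : ℝ} (hb : 0 < b) (a : ℝ) :
    BdryCond 2 (fun x : Fin 2 → ℝ => ![a, layer b (x 0)]) ![a, -b] ![a, b] := by
  rw [BdryCond, funext (avg_layerField a b)]
  exact ⟨tendsto_layerCurve_atBot hb a, tendsto_layerCurve_atTop hb a⟩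

lemma energy_layerField {W : (Fin 2 → ℝ) → ℝ}
    (hW : ∀ z, W z = (1 / 2) * (1 - (z 0 ^ 2 + z 1 ^ 2)) ^ 2) {a b : ℝ} (hb : 0 < b)
    (hab : a ^ 2 + b ^ 2 = 1) :
    energy 2 W (fun x : Fin 2 → ℝ => ![a, layer b (x 0)]) = ENNReal.ofReal (4 * b ^ 3 / 3) := by
  have h1 : ∀ x, eden W (fun x : Fin 2 → ℝ => ![a, layer b (x 0)]) x
      = (b ^ 2 - layer b (x 0) ^ 2) ^ 2 := fun x => by
    have h2 : 1 - (a ^ 2 + layer b (x 0) ^ 2) = b ^ 2 - layer b (x 0) ^ 2 := by linarith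
    simp only [eden, gradSq_layerField, hW, Matrix.cons_val_zero, Matrix.cons_val_one, h2]
    ring
  have hc : Continuous (layer b) := (contDiff_layer b).continuous
  simp only [energy, h1]
  rw [← lintegral_layer_deriv_sq hb, ← measurePreserving_strip_fst.lintegral_comp
    (f := fun t => ENNReal.ofReal ((b ^ 2 - layer b t ^ 2) ^ 2)) (by fun_prop)]

end Plane

section OneDimProblem

variable {W : (Fin 2 → ℝ) → ℝ} {a b : ℝ} {γ : ℝ → Fin 2 → ℝ}

lemma Adm1D.hasDerivAt_one {um up : Fin 2 → ℝ} (h : Adm1D 2 a um up γ) (t : ℝ) :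
    HasDerivAt (fun t => γ t 1) (deriv γ t 1) t :=
  hasDerivAt_pi.1 (h.1 t).hasDerivAt 1

lemma Adm1D.energy1D_eq (hW : ∀ z, W z = (1 / 2) * (1 - (z 0 ^ 2 + z 1 ^ 2)) ^ 2)
    (hab : a ^ 2 + b ^ 2 = 1) {um up : Fin 2 → ℝ} (h : Adm1D 2 a um up γ) :
    energy1D 2 W γ = ∫⁻ t, ENNReal.ofReal
      (1 / 2 * deriv γ t 1 ^ 2 + 1 / 2 * (b ^ 2 - γ t 1 ^ 2) ^ 2) := by
  refine lintegral_congr fun t => ?_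
  have h0 : deriv γ t 0 = 0 := by
    have h1 := hasDerivAt_pi.1 (h.1 t).hasDerivAt 0
    simp only [h.2.1] at h1
    exact h1.unique (hasDerivAt_const t a)
  have h2 : 1 - (a ^ 2 + γ t 1 ^ 2) = b ^ 2 - γ t 1 ^ 2 := by linarith
  simp [vnorm2, h0, hW, h.2.1, h2]

/-- Connecting curves with small energy are translated layers. -/
lemma Adm1D.eq_layer_of_energy1D_le (hW : ∀ z, W z = (1 / 2) * (1 - (z 0 ^ 2 + z 1 ^ 2)) ^ 2)
    (hb : 0 < b) (hab : a ^ 2 + b ^ 2 = 1) (h : Adm1D 2 a ![a, -b] ![a, b] γ)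
    (hE : energy1D 2 W γ ≤ ENNReal.ofReal (4 * b ^ 3 / 3)) :
    ∃ τ, ∀ t, γ t = ![a, layer b (t + τ)] := by
  rw [h.energy1D_eq hW hab] at hE
  have hbot : Tendsto (fun t => γ t 1) atBot (𝓝 (-b)) := by
    simpa using tendsto_pi_nhds.1 h.2.2.1 1
  have htop : Tendsto (fun t => γ t 1) atTop (𝓝 b) := by
    simpa using tendsto_pi_nhds.1 h.2.2.2 1
  have hode := ode_of_energy_le hb h.hasDerivAt_one hbot htop hE
  obtain ⟨τ, hτ⟩ := eq_layer_of_ode hb (fun t => hode t ▸ h.hasDerivAt_one t) hbot htop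
  refine ⟨τ, fun t => ?_⟩
  ext i
  fin_cases i
  · exact h.2.1 t
  · exact hτ t

lemma hasDerivAt_layerCurve (a b τ t : ℝ) :
    HasDerivAt (fun t => ![a, layer b (t + τ)]) ![0, b ^ 2 - layer b (t + τ) ^ 2] t := by
  refine hasDerivAt_pi.2 fun i => ?_
  fin_cases i
  · exact hasDerivAt_const t a
  · exact (hasDerivAt_layer b (t + τ)).comp_add_const t τ

lemma adm1D_layerCurve (hb : 0 < b) (a τ : ℝ) :
    Adm1D 2 a ![a, -b] ![a, b] fun t => ![a, layer b (t + τ)] :=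
  ⟨fun t => (hasDerivAt_layerCurve a b τ t).differentiableAt, fun _ => rfl,
    (tendsto_layerCurve_atBot hb a).comp (tendsto_atBot_add_const_right _ τ tendsto_id),
    (tendsto_layerCurve_atTop hb a).comp (tendsto_atTop_add_const_right _ τ tendsto_id)⟩

lemma energy1D_layerCurve (hW : ∀ z, W z = (1 / 2) * (1 - (z 0 ^ 2 + z 1 ^ 2)) ^ 2)
    (hb : 0 < b) (hab : a ^ 2 + b ^ 2 = 1) (τ : ℝ) :
    energy1D 2 W (fun t => ![a, layer b (t + τ)]) = ENNReal.ofReal (4 * b ^ 3 / 3) := by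
  rw [(adm1D_layerCurve hb a τ).energy1D_eq hW hab, ← lintegral_layer_deriv_sq hb,
    ← lintegral_add_right_eq_self (fun t => ENNReal.ofReal ((b ^ 2 - layer b t ^ 2) ^ 2)) τ]
  refine lintegral_congr fun t => ?_
  rw [(hasDerivAt_layerCurve a b τ t).deriv]
  simp only [Matrix.cons_val_one, Matrix.cons_val_zero]
  congr 1
  ring

lemma Adm1D.le_energy1D (hW : ∀ z, W z = (1 / 2) * (1 - (z 0 ^ 2 + z 1 ^ 2)) ^ 2)
    (hb : 0 < b) (hab : a ^ 2 + b ^ 2 = 1) (h : Adm1D 2 a ![a, -b] ![a, b] γ) :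
    ENNReal.ofReal (4 * b ^ 3 / 3) ≤ energy1D 2 W γ := by
  rcases le_total (energy1D 2 W γ) (ENNReal.ofReal (4 * b ^ 3 / 3)) with hE | hE
  · obtain ⟨τ, hτ⟩ := h.eq_layer_of_energy1D_le hW hb hab hE
    rw [funext hτ, energy1D_layerCurve hW hb hab]
  · exact hE

end OneDimProblem

/-- Corollary `symmetry_ag`: for the Ginzburg–Landau (Aviles–Giga) potential
`W(z) = ½(1-|z|²)²` in dimension `2` and wells `u^± = (a, ±b)` with `a² + b² = 1`, every
global minimizer of `(P)` is one-dimensional: `u(x) = g(x₁)` with `g ∈ C²` the unique (up to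
translation in `x₁`) minimizer of the 1D problem. -/
theorem statement6
    (W : (Fin 2 → ℝ) → ℝ) (hW : ∀ z, W z = (1 / 2) * (1 - (z 0 ^ 2 + z 1 ^ 2)) ^ 2)
    (a b : ℝ) (hb : 0 < b) (hab : a ^ 2 + b ^ 2 = 1)
    (um up : Fin 2 → ℝ) (hum : um = ![a, -b]) (hup : up = ![a, b])
    (u : (Fin 2 → ℝ) → Fin 2 → ℝ)
    (hadm : Adm 2 u) (hbc : BdryCond 2 u um up)
    (hmin : ∀ v, Adm 2 v → BdryCond 2 v um up → energy 2 W u ≤ energy 2 W v) :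
    ∃ g : ℝ → Fin 2 → ℝ,
      (∀ x, u x = g (x 0)) ∧
      ContDiff ℝ 2 (fun t => g t) ∧
      Adm1D 2 a um up g ∧
      (∀ γ, Adm1D 2 a um up γ → energy1D 2 W g ≤ energy1D 2 W γ) ∧
      (∀ γ, Adm1D 2 a um up γ →
        (∀ γ', Adm1D 2 a um up γ' → energy1D 2 W γ ≤ energy1D 2 W γ') →
        ∃ τ : ℝ, ∀ t, γ t = g (t + τ)) := by
  subst hum hup
  obtain ⟨τ, hτ⟩ := hadm.eq_layer_of_energy_le hW hb hab hbc
    ((hmin _ (adm_layerField hb a) (bdryCond_layerField hb a)).trans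
      (energy_layerField hW hb hab).le)
  refine ⟨fun t => ![a, layer b (t + τ)], hτ, ?_, adm1D_layerCurve hb a τ, fun γ hγ => ?_,
    fun γ hγ hγmin => ?_⟩
  · refine contDiff_pi.2 fun i => ?_
    fin_cases i
    · exact contDiff_const
    · exact (contDiff_layer b).comp (contDiff_id.add contDiff_const)
  · rw [energy1D_layerCurve hW hb hab]
    exact hγ.le_energy1D hW hb hab
  · obtain ⟨σ, hσ⟩ := hγ.eq_layer_of_energy1D_le hW hb hab
      ((hγmin _ (adm1D_layerCurve hb a 0)).trans (energy1D_layerCurve hW hb hab 0).le)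
    exact ⟨σ - τ, fun t => by simp [hσ, add_assoc]⟩
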